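/- Let μ = m∘Π⁻¹. Suppose there are constants h(μ) ≤ 0 and χ₂(μ) ≤ χ₁(μ) < 0 such that for m-almost every i ∈ Σ: lim_{n→∞} (1/n) log m([i|n]) = h(μ), lim_{n→∞} (1/n) log α₁(D_{Π(σⁿi)} S_{i|n}) = χ₁(μ), and lim_{n→∞} (1/n) log α₂(D_{Π(σⁿi)} S_{i|n}) = χ₂(μ), and suppose π(μ) is exact dimensional with exact dimension t. Then for μ-almost every x, the lower local dimension satisfies liminf_{r→0} log μ(B(x,r))/log r ≥ h(μ)/χ₂(μ) + ((χ₂(μ) − χ₁(μ))/χ₂(μ))·t. -/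

import Mathlib

open MeasureTheory Filter Set

noncomputable section

namespace FFL

/-- The unit square `[0,1]² ⊆ ℝ²`. -/
def sq : Set (ℝ × ℝ) := Set.Icc (0:ℝ) 1 ×ˢ Set.Icc (0:ℝ) 1

/-- The Euclidean metric on `ℝ²`. -/
def dE (a b : ℝ × ℝ) : ℝ := Real.sqrt ((a.1 - b.1) ^ 2 + (a.2 - b.2) ^ 2)

/-- Squared Frobenius norm of a 2×2 real matrix. -/
def frobSq (A : Matrix (Fin 2) (Fin 2) ℝ) : ℝ := ∑ i, ∑ j, (A i j) ^ 2

/-- The larger singular value `α₁` of a 2×2 real matrix, i.e. the larger positive square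
root of the eigenvalues of `AᵀA`, via the standard closed formula. -/
def sv1 (A : Matrix (Fin 2) (Fin 2) ℝ) : ℝ :=
  Real.sqrt ((frobSq A + Real.sqrt ((frobSq A) ^ 2 - 4 * (A.det) ^ 2)) / 2)

/-- The smaller singular value `α₂` of a 2×2 real matrix. -/
def sv2 (A : Matrix (Fin 2) (Fin 2) ℝ) : ℝ :=
  Real.sqrt ((frobSq A - Real.sqrt ((frobSq A) ^ 2 - 4 * (A.det) ^ 2)) / 2)

/-- The nonlinear, non-conformal iterated function systems of Falconer, Fraser and Lee:
maps `S i (a₁,a₂) = (f i a₁, g i (a₁,a₂))` on the unit square, where `f i`, `g i` are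
`C^{1+α}` contractions (with partial derivatives `fx`, `gx`, `gy`) satisfying the
domination condition. -/
structure System (I : Type) [Fintype I] where
  f : I → ℝ → ℝ
  g : I → ℝ × ℝ → ℝ
  fx : I → ℝ → ℝ
  gx : I → ℝ × ℝ → ℝ
  gy : I → ℝ × ℝ → ℝ
  /-- the index set has at least two elements -/
  card2 : 2 ≤ Fintype.card I
  /-- each `S i` maps the unit square into itself -/
  mapsTo : ∀ i, Set.MapsTo (fun a => (f i a.1, g i a)) sq sq
  /-- `fx i` is the derivative of `f i` on `[0,1]` -/
  hasDeriv_f : ∀ i, ∀ x ∈ Set.Icc (0:ℝ) 1,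
    HasDerivWithinAt (f i) (fx i x) (Set.Icc (0:ℝ) 1) x
  /-- `(gx i, gy i)` is the (total) derivative of `g i` on the unit square -/
  hasDeriv_g : ∀ i, ∀ a ∈ sq, HasFDerivWithinAt (g i)
      (gx i a • ContinuousLinearMap.fst ℝ ℝ ℝ + gy i a • ContinuousLinearMap.snd ℝ ℝ ℝ) sq a
  /-- the derivatives are `α`-Hölder for some `α > 0`, i.e. `f i`, `g i` are `C^{1+α}` -/
  holder : ∃ α > (0:ℝ), ∃ H > (0:ℝ), ∀ i,
      (∀ x ∈ Set.Icc (0:ℝ) 1, ∀ y ∈ Set.Icc (0:ℝ) 1, |fx i x - fx i y| ≤ H * |x - y| ^ α) ∧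
      (∀ a ∈ sq, ∀ b ∈ sq, |gx i a - gx i b| ≤ H * dE a b ^ α) ∧
      (∀ a ∈ sq, ∀ b ∈ sq, |gy i a - gy i b| ≤ H * dE a b ^ α)
  /-- the maps `f i`, `g i` (hence `S i`) are uniform contractions -/
  contracting : ∃ c, 0 ≤ c ∧ c < 1 ∧ ∀ i,
      (∀ x ∈ Set.Icc (0:ℝ) 1, ∀ y ∈ Set.Icc (0:ℝ) 1, |f i x - f i y| ≤ c * |x - y|) ∧
      (∀ a ∈ sq, ∀ b ∈ sq, |g i a - g i b| ≤ c * dE a b) ∧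
      (∀ a ∈ sq, ∀ b ∈ sq, dE (f i a.1, g i a) (f i b.1, g i b) ≤ c * dE a b)
  /-- the domination condition:
  `inf |f_{i,x}| > sup |g_{i,y}| ≥ inf |g_{i,y}| ≥ d > 0` -/
  domination : ∃ d > (0:ℝ), ∀ i,
      d ≤ sInf ((fun a => |gy i a|) '' sq) ∧
      sSup ((fun a => |gy i a|) '' sq) < sInf ((fun x => |fx i x|) '' Set.Icc (0:ℝ) 1)

variable {I : Type} [Fintype I]

/-- The map `S i`. -/
def S (T : System I) (i : I) (a : ℝ × ℝ) : ℝ × ℝ := (T.f i a.1, T.g i a)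

/-- The composition `S_w = S_{i₁} ∘ ⋯ ∘ S_{i_n}` along a finite word `w = (i₁,…,i_n)`. -/
def Sw (T : System I) : List I → ℝ × ℝ → ℝ × ℝ
  | [], a => a
  | i :: w, a => S T i (Sw T w a)

/-- The top-left entry `f_{w,x}(a)` of the (lower triangular) Jacobian `D_a S_w`,
via the chain rule. -/
def fxw (T : System I) : List I → ℝ × ℝ → ℝ
  | [], _ => 1
  | i :: w, a => T.fx i (Sw T w a).1 * fxw T w a

/-- The bottom-right entry `g_{w,y}(a)` of the Jacobian `D_a S_w`. -/
def gyw (T : System I) : List I → ℝ × ℝ → ℝ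
  | [], _ => 1
  | i :: w, a => T.gy i (Sw T w a) * gyw T w a

/-- The off-diagonal entry `g_{w,x}(a)` of the Jacobian `D_a S_w`. -/
def gxw (T : System I) : List I → ℝ × ℝ → ℝ
  | [], _ => 0
  | i :: w, a => T.gx i (Sw T w a) * fxw T w a + T.gy i (Sw T w a) * gxw T w a

/-- The Jacobian matrix `D_a S_w`. -/
def Dmat (T : System I) (w : List I) (a : ℝ × ℝ) : Matrix (Fin 2) (Fin 2) ℝ :=
  !![fxw T w a, 0; gxw T w a, gyw T w a]

/-- The larger singular value `α₁(D_a S_w)`. -/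
def alpha1 (T : System I) (w : List I) (a : ℝ × ℝ) : ℝ := sv1 (Dmat T w a)

/-- The smaller singular value `α₂(D_a S_w)`. -/
def alpha2 (T : System I) (w : List I) (a : ℝ × ℝ) : ℝ := sv2 (Dmat T w a)

/-- The restriction `i|n` of an infinite sequence to its first `n` symbols. -/
def word (ii : ℕ → I) (n : ℕ) : List I := List.ofFn (fun k : Fin n => ii k.1)

/-- The iterated left shift `σⁿ`. -/
def shiftn (ii : ℕ → I) (n : ℕ) : ℕ → I := fun k => ii (k + n)

/-- The left shift `σ` on `Σ = I^ℕ`. -/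
def shift (ii : ℕ → I) : ℕ → I := fun k => ii (k + 1)

/-- The cylinder set `[w] ⊆ Σ` of a finite word `w`. -/
def cyl (w : List I) : Set (ℕ → I) := {jj | ∀ k : Fin w.length, jj k.1 = w.get k}

/-- `F` is the attractor of the IFS: the (unique) nonempty compact subset of the unit
square with `F = ⋃ i, S i '' F`. -/
def IsAttractor (T : System I) (F : Set (ℝ × ℝ)) : Prop :=
  F.Nonempty ∧ IsCompact F ∧ F ⊆ sq ∧ F = ⋃ i, S T i '' F

/-- The strong separation condition: the sets `S i '' F` are pairwise disjoint. -/
def SSC (T : System I) (F : Set (ℝ × ℝ)) : Prop :=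
  ∀ i j : I, i ≠ j → Disjoint (S T i '' F) (S T j '' F)

/-- `Pi` is the canonical coding map `Π : Σ → [0,1]²`:
`Π(i)` is the unique point of `⋂ₙ S_{i|n}([0,1]²)`. -/
def IsCoding (T : System I) (Pi : (ℕ → I) → ℝ × ℝ) : Prop :=
  ∀ ii : ℕ → I, ∀ n : ℕ, Pi ii ∈ Sw T (word ii n) '' sq

/-- `m` is quasi-Bernoulli with constant `L`:
`L⁻¹ m[w] m[v] ≤ m[wv] ≤ L m[w] m[v]` for all finite words `w, v`. -/
def QuasiBernoulli [MeasurableSpace I] (m : Measure (ℕ → I)) (L : ℝ) : Prop :=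
  0 < L ∧ ∀ w v : List I,
    L⁻¹ * (m (cyl w)).toReal * (m (cyl v)).toReal ≤ (m (cyl (w ++ v))).toReal ∧
    (m (cyl (w ++ v))).toReal ≤ L * (m (cyl w)).toReal * (m (cyl v)).toReal

/-- The interval `Q₁(x,r) = [x - r/2, x + r/2]`. -/
def Q1 (x r : ℝ) : Set ℝ := Set.Icc (x - r / 2) (x + r / 2)

/-- The square `Q₂(a,r) = (a₁ - r/2, a₁ + r/2) × (a₂ - r/2, a₂ + r/2)`. -/
def Q2 (a : ℝ × ℝ) (r : ℝ) : Set (ℝ × ℝ) :=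
  Set.Ioo (a.1 - r / 2) (a.1 + r / 2) ×ˢ Set.Ioo (a.2 - r / 2) (a.2 + r / 2)

/-- The approximate square `B_n(a,r)`: points `b ∈ S_w([0,1]²)` with `|b₁ - a₁| ≤ r/2`. -/
def Bn (T : System I) (w : List I) (a : ℝ × ℝ) (r : ℝ) : Set (ℝ × ℝ) :=
  {b ∈ Sw T w '' sq | |b.1 - a.1| ≤ r / 2}

/-- The closed Euclidean ball in `ℝ²`. -/
def ballE (x : ℝ × ℝ) (r : ℝ) : Set (ℝ × ℝ) := {y | dE x y ≤ r}

/-- A measure on `ℝ` is exact dimensional with dimension `s` if for a.e. `x`,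
`log ν(B(x,r)) / log r → s` as `r → 0⁺`. -/
def ExactDim1 (ν : Measure ℝ) (s : ℝ) : Prop :=
  ∀ᵐ x ∂ν, Tendsto (fun r => Real.log (ν (Metric.closedBall x r)).toReal / Real.log r)
    (nhdsWithin 0 (Set.Ioi 0)) (nhds s)

/-- A measure on `ℝ²` is exact dimensional with dimension `s` (w.r.t. Euclidean balls). -/
def ExactDim2 (ν : Measure (ℝ × ℝ)) (s : ℝ) : Prop :=
  ∀ᵐ x ∂ν, Tendsto (fun r => Real.log (ν (ballE x r)).toReal / Real.log r)
    (nhdsWithin 0 (Set.Ioi 0)) (nhds s)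

/-- `η = sup_{i ∈ I, a, b ∈ [0,1]²} |g_{i,y}(a)| / |f_{i,x}(b)|`. -/
def eta (T : System I) : ℝ :=
  sSup {x : ℝ | ∃ i : I, ∃ a ∈ sq, ∃ b ∈ sq, x = |T.gy i a| / |T.fx i b.1|}

end FFL

namespace FFL

/-- The running maximum `max(0, g, g + g ∘ T, …)` of the first `n` nonempty Birkhoff sums. -/
def maxSum {α : Type*} (T : α → α) (g : α → ℝ) : ℕ → α → ℝ
  | 0, _ => 0
  | n + 1, x => max 0 (g x + maxSum T g n (T x))

section MaximalErgodic

variable {α : Type*} {T : α → α} {g : α → ℝ}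

lemma maxSum_nonneg (n : ℕ) (x : α) : 0 ≤ maxSum T g n x := by
  cases n with
  | zero => exact le_rfl
  | succ n => exact le_max_left _ _

lemma maxSum_le_succ (n : ℕ) (x : α) : maxSum T g n x ≤ maxSum T g (n + 1) x := by
  induction n generalizing x with
  | zero => exact maxSum_nonneg 1 x
  | succ n ih =>
    have := ih (T x)
    rw [maxSum, maxSum]
    gcongr

lemma maxSum_le (hg : ∀ x, g x ≤ 1) (n : ℕ) (x : α) : maxSum T g n x ≤ n := by
  induction n generalizing x with
  | zero => simp [maxSum]
  | succ n ih =>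
    have := ih (T x)
    have := hg x
    rw [maxSum]
    push_cast
    exact max_le (by positivity) (by linarith)

lemma birkhoffSum_le_maxSum (n : ℕ) (x : α) : birkhoffSum T g n x ≤ maxSum T g n x := by
  induction n generalizing x with
  | zero => simp [maxSum]
  | succ n ih =>
    rw [birkhoffSum_succ', maxSum]
    exact le_max_of_le_right (by gcongr; exact ih _)

variable [MeasurableSpace α] {m : Measure α}

lemma measurable_maxSum (hT : Measurable T) (hg : Measurable g) (n : ℕ) :
    Measurable (maxSum T g n) := by
  induction n with
  | zero => exact measurable_const
  | succ n ih => exact measurable_const.max (hg.add (ih.comp hT))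

/-- The maximal ergodic theorem, for a function bounded above by `1`. -/
lemma integral_indicator_maxSum_nonneg [IsProbabilityMeasure m] (hT : MeasurePreserving T m m)
    (hg : Measurable g) (hg1 : ∀ x, g x ≤ 1) (hgi : Integrable g m) (n : ℕ) :
    0 ≤ ∫ x in {x | 0 < maxSum T g n x}, g x ∂m := by
  have hmeas := measurable_maxSum hT.measurable hg n
  have hE : MeasurableSet {x | 0 < maxSum T g n x} := measurableSet_lt measurable_const hmeas
  have hint : Integrable (maxSum T g n) m := by
    refine Integrable.of_bound hmeas.aestronglyMeasurable n (ae_of_all _ fun x => ?_)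
    rw [Real.norm_of_nonneg (maxSum_nonneg n x)]
    exact maxSum_le hg1 n x
  have hint' : Integrable (fun x => maxSum T g n (T x)) m := hT.integrable_comp_of_integrable hint
  have hcomp : ∫ x, maxSum T g n (T x) ∂m = ∫ x, maxSum T g n x ∂m := by
    rw [← integral_map hT.measurable.aemeasurable (by
      rw [hT.map_eq]; exact hmeas.aestronglyMeasurable), hT.map_eq]
  rw [← integral_indicator hE]
  calc (0 : ℝ) = ∫ x, (maxSum T g n x - maxSum T g n (T x)) ∂m := by
        rw [integral_sub hint hint', hcomp, sub_self]
    _ ≤ _ := by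
        refine integral_mono (hint.sub hint') (hgi.indicator hE) fun x => ?_
        by_cases hx : 0 < maxSum T g n x
        · rw [indicator_of_mem (by exact hx)]
          cases n with
          | zero => simp [maxSum] at hx
          | succ n =>
            have h1 := maxSum_le_succ (T := T) (g := g) n (T x)
            have h2 : maxSum T g (n + 1) x = g x + maxSum T g n (T x) := by
              rw [maxSum] at hx ⊢
              exact max_eq_right (le_of_lt ((lt_max_iff.1 hx).resolve_left (lt_irrefl _)))
            simp only
            linarith
        · rw [indicator_of_notMem (by exact hx)]
          have := maxSum_nonneg (T := T) (g := g) n (T x)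
          simp only
          linarith

/-- The weak-type maximal inequality for the frequency of visits to a set `A`. -/
lemma measureReal_maxSum_pos_le [IsProbabilityMeasure m] (hT : MeasurePreserving T m m)
    {A : Set α} (hA : MeasurableSet A) {δ : ℝ} (hδ : 0 < δ) :
    m.real {x | ∃ n, 0 < maxSum T (fun x => A.indicator 1 x - δ) n x} ≤ m.real A / δ := by
  set g : α → ℝ := fun x => A.indicator 1 x - δ with hgdef
  have hg : Measurable g := (measurable_one.indicator hA).sub measurable_const
  have hi1 : Integrable (A.indicator (1 : α → ℝ)) m := (integrable_const (1 : ℝ)).indicator hA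
  have hgi : Integrable g m := hi1.sub (integrable_const δ)
  have hg1 : ∀ x, g x ≤ 1 := fun x => by
    have : A.indicator (1 : α → ℝ) x ≤ 1 := indicator_le_self' (by simp) x
    simp only [hgdef]
    linarith
  have hn : ∀ n, m.real {x | 0 < maxSum T g n x} ≤ m.real A / δ := by
    intro n
    have h0 := integral_indicator_maxSum_nonneg hT hg hg1 hgi n
    rw [integral_sub hi1.integrableOn (integrable_const δ).integrableOn, integral_indicator_one hA,
      setIntegral_const, smul_eq_mul] at h0
    rw [le_div_iff₀ hδ]
    have : (m.restrict {x | 0 < maxSum T g n x}).real A ≤ m.real A :=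
      ENNReal.toReal_mono (measure_ne_top _ _) (Measure.restrict_apply_le _ _)
    linarith
  have hU : {x | ∃ n, 0 < maxSum T g n x} = ⋃ n, {x | 0 < maxSum T g n x} := by
    ext; simp
  have hmono : Monotone fun n => {x | 0 < maxSum T g n x} :=
    monotone_nat_of_le_succ fun n x hx => lt_of_lt_of_le hx (maxSum_le_succ n x)
  rw [hU]
  have ht := (ENNReal.tendsto_toReal (measure_ne_top m _)).comp
    (tendsto_measure_iUnion_atTop (μ := m) hmono)
  exact le_of_tendsto' ht hn

/-- If the sets `A C` decrease to a null set, then almost every orbit, for a suitable `C`,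
leaves `A C` at some time in every window `[(1 - δ) n, n]`. -/
lemma ae_exists_forall_exists_iterate_notMem [IsProbabilityMeasure m]
    (hT : MeasurePreserving T m m) {A : ℕ → Set α} (hA : ∀ C, MeasurableSet (A C))
    (hlim : Tendsto (fun C => m.real (A C)) atTop (nhds 0)) {δ : ℝ} (hδ : 0 < δ)
    (hδ1 : δ ≤ 1) :
    ∀ᵐ x ∂m, ∃ C, ∀ n : ℕ, 1 ≤ n → ∃ k : ℕ, (1 - δ) * n ≤ k ∧ k ≤ n ∧ T^[k] x ∉ A C := by
  have hδ4 : 0 < δ / 4 := by positivity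
  set B : ℕ → Set α := fun C =>
    {x | ∃ n, 0 < maxSum T (fun x => (A C).indicator 1 x - δ / 4) n x}
  have hB : m.real (⋂ C, B C) ≤ 0 := by
    have h1 : Tendsto (fun C => m.real (A C) / (δ / 4)) atTop (nhds 0) := by
      simpa using hlim.div_const (δ / 4)
    refine ge_of_tendsto' h1 fun C => ?_
    exact (measureReal_mono (iInter_subset _ C)).trans (measureReal_maxSum_pos_le hT (hA C) hδ4)
  have hB0 : m (⋂ C, B C) = 0 := by
    have := le_antisymm hB measureReal_nonneg
    rwa [measureReal_eq_zero_iff] at this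
  refine measure_mono_null (fun x hx => ?_) hB0
  simp only [mem_compl_iff, mem_ofPred_eq, not_exists, not_forall] at hx
  refine mem_iInter.2 fun C => ?_
  obtain ⟨n, hn1, hn⟩ := hx C
  have hn' : ∀ k : ℕ, (1 - δ) * n ≤ k → k ≤ n → T^[k] x ∈ A C := fun k h1 h2 => by
    by_contra h3
    exact hn k ⟨h1, h2, h3⟩
  refine ⟨n + 1, lt_of_lt_of_le ?_ (birkhoffSum_le_maxSum _ _)⟩
  have hcard : δ * n ≤ ∑ k ∈ Finset.range (n + 1), (A C).indicator (1 : α → ℝ) (T^[k] x) := by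
    set k₀ := ⌈(1 - δ) * n⌉₊ with hk₀
    have h0 : 0 ≤ (1 - δ) * n := mul_nonneg (by linarith) (Nat.cast_nonneg n)
    have hk : k₀ ≤ n := Nat.ceil_le.2 (by nlinarith [(Nat.cast_nonneg n : (0 : ℝ) ≤ n)])
    calc δ * n ≤ ((n + 1 - k₀ : ℕ) : ℝ) := by
          rw [Nat.cast_sub (by omega)]
          have := Nat.ceil_lt_add_one h0
          push_cast
          linarith
      _ = ∑ k ∈ Finset.Ico k₀ (n + 1), (1 : ℝ) := by simp
      _ = ∑ k ∈ Finset.Ico k₀ (n + 1), (A C).indicator (1 : α → ℝ) (T^[k] x) := by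
          refine Finset.sum_congr rfl fun k hk => ?_
          rw [Finset.mem_Ico] at hk
          rw [indicator_of_mem (hn' k (Nat.ceil_le.1 hk.1) (by omega))]
          rfl
      _ ≤ _ := by
          refine Finset.sum_le_sum_of_subset_of_nonneg (fun k hk => ?_) fun k _ _ =>
            indicator_nonneg (by simp) _
          simp only [Finset.mem_Ico, Finset.mem_range] at hk ⊢
          omega
  have hn1' : (1 : ℝ) ≤ n := by exact_mod_cast hn1
  rw [birkhoffSum]
  simp only [Finset.sum_sub_distrib, Finset.sum_const, Finset.card_range, nsmul_eq_mul]
  push_cast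
  nlinarith

end MaximalErgodic

section EuclideanDistance

lemma dE_nonneg (a b : ℝ × ℝ) : 0 ≤ dE a b := Real.sqrt_nonneg _

lemma abs_fst_sub_le_dE (a b : ℝ × ℝ) : |a.1 - b.1| ≤ dE a b :=
  Real.abs_le_sqrt (by nlinarith [sq_nonneg (a.2 - b.2)])

lemma abs_snd_sub_le_dE (a b : ℝ × ℝ) : |a.2 - b.2| ≤ dE a b :=
  Real.abs_le_sqrt (by nlinarith [sq_nonneg (a.1 - b.1)])

lemma dE_le_abs_add_abs (a b : ℝ × ℝ) : dE a b ≤ |a.1 - b.1| + |a.2 - b.2| := by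
  refine Real.sqrt_le_iff.2 ⟨by positivity, ?_⟩
  nlinarith [sq_abs (a.1 - b.1), sq_abs (a.2 - b.2),
    mul_nonneg (abs_nonneg (a.1 - b.1)) (abs_nonneg (a.2 - b.2))]

lemma dist_le_dE (a b : ℝ × ℝ) : dist a b ≤ dE a b := by
  rw [Prod.dist_eq, Real.dist_eq, Real.dist_eq]
  exact max_le (abs_fst_sub_le_dE a b) (abs_snd_sub_le_dE a b)

lemma continuous_dE : Continuous fun p : (ℝ × ℝ) × (ℝ × ℝ) => dE p.1 p.2 := by
  unfold dE
  fun_prop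

lemma measurableSet_ballE (x : ℝ × ℝ) (r : ℝ) : MeasurableSet (ballE x r) :=
  (isClosed_le (continuous_dE.comp (Continuous.prodMk_right x)) continuous_const).measurableSet

lemma dE_le_two {a b : ℝ × ℝ} (ha : a ∈ sq) (hb : b ∈ sq) : dE a b ≤ 2 := by
  obtain ⟨⟨h1, h2⟩, h3, h4⟩ := ha
  obtain ⟨⟨h5, h6⟩, h7, h8⟩ := hb
  have e1 : |a.1 - b.1| ≤ 1 := abs_le.2 ⟨by linarith, by linarith⟩
  have e2 : |a.2 - b.2| ≤ 1 := abs_le.2 ⟨by linarith, by linarith⟩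
  linarith [dE_le_abs_add_abs a b]

lemma zero_mem_sq : (0 : ℝ × ℝ) ∈ sq := by
  constructor <;> simp

lemma convex_sq : Convex ℝ sq := (convex_Icc 0 1).prod (convex_Icc 0 1)

end EuclideanDistance

section Geometry

variable {I : Type} [Fintype I] (T : System I)

lemma Sw_append (u v : List I) (a : ℝ × ℝ) : Sw T (u ++ v) a = Sw T u (Sw T v a) := by
  induction u with
  | nil => rfl
  | cons i u ih => simp only [List.cons_append, Sw, ih]

lemma gyw_append (u v : List I) (a : ℝ × ℝ) :
    gyw T (u ++ v) a = gyw T u (Sw T v a) * gyw T v a := by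
  induction u with
  | nil => simp [gyw]
  | cons i u ih => simp only [List.cons_append, gyw, ih, Sw_append, mul_assoc]

lemma Sw_mem_sq (w : List I) {a : ℝ × ℝ} (ha : a ∈ sq) : Sw T w a ∈ sq := by
  induction w with
  | nil => exact ha
  | cons i w ih => exact T.mapsTo i ih

lemma System.nonempty_index {I : Type} [Fintype I] (T : System I) : Nonempty I :=
  Fintype.card_pos_iff.1 (by have := T.card2; omega)

lemma exists_dE_Sw_le : ∃ c : ℝ, 0 < c ∧ c < 1 ∧ ∀ w : List I, ∀ a ∈ sq, ∀ b ∈ sq,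
    dE (Sw T w a) (Sw T w b) ≤ c ^ w.length * dE a b := by
  obtain ⟨c, hc0, hc1, hc⟩ := T.contracting
  refine ⟨max c (1 / 2), by positivity, max_lt hc1 (by norm_num), fun w a ha b hb => ?_⟩
  induction w with
  | nil => simp [Sw]
  | cons i w ih =>
    have h1 := (hc i).2.2 _ (Sw_mem_sq T w ha) _ (Sw_mem_sq T w hb)
    calc dE (Sw T (i :: w) a) (Sw T (i :: w) b) ≤ c * dE (Sw T w a) (Sw T w b) := h1
      _ ≤ max c (1 / 2) * (max c (1 / 2) ^ w.length * dE a b) :=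
        mul_le_mul (le_max_left _ _) ih (dE_nonneg _ _) (by positivity)
      _ = _ := by rw [List.length_cons, pow_succ]; ring

lemma exists_partials_le : ∃ M : ℝ, 0 ≤ M ∧ ∀ i, ∀ a ∈ sq, |T.gx i a| ≤ M ∧ |T.gy i a| ≤ M := by
  obtain ⟨α, hα, H, hH, hh⟩ := T.holder
  have key : ∀ (φ : I → ℝ × ℝ → ℝ),
      (∀ i, ∀ a ∈ sq, ∀ b ∈ sq, |φ i a - φ i b| ≤ H * dE a b ^ α) →
      ∀ i, ∀ a ∈ sq, |φ i a| ≤ ∑ j, |φ j 0| + H * 2 ^ α := by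
    intro φ hφ i a ha
    have h1 := hφ i a ha 0 zero_mem_sq
    have h2 : H * dE a 0 ^ α ≤ H * 2 ^ α := mul_le_mul_of_nonneg_left
      (Real.rpow_le_rpow (dE_nonneg _ _) (dE_le_two ha zero_mem_sq) hα.le) hH.le
    have h3 : |φ i 0| ≤ ∑ j, |φ j 0| :=
      Finset.single_le_sum (f := fun j => |φ j 0|) (fun j _ => abs_nonneg _) (Finset.mem_univ i)
    have h4 := abs_sub_abs_le_abs_sub (φ i a) (φ i 0)
    linarith
  have hx := key T.gx fun i => (hh i).2.1
  have hy := key T.gy fun i => (hh i).2.2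
  refine ⟨max (∑ j, |T.gx j 0| + H * 2 ^ α) (∑ j, |T.gy j 0| + H * 2 ^ α),
    le_max_of_le_left (by positivity), fun i a ha => ⟨?_, ?_⟩⟩
  · exact (hx i a ha).trans (le_max_left _ _)
  · exact (hy i a ha).trans (le_max_right _ _)

lemma exists_abs_fx_le_one (i : I) : ∃ x ∈ Icc (0 : ℝ) 1, |T.fx i x| ≤ 1 := by
  obtain ⟨x, hx, h⟩ := exists_hasDerivAt_eq_slope (T.f i) (T.fx i) zero_lt_one
    (fun x hx => (T.hasDeriv_f i x hx).continuousWithinAt)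
    (fun x hx => (T.hasDeriv_f i x (Ioo_subset_Icc_self hx)).hasDerivAt (Icc_mem_nhds hx.1 hx.2))
  refine ⟨x, Ioo_subset_Icc_self hx, ?_⟩
  have h0 := (T.mapsTo i (x := (0, 0)) (by simp [sq])).1
  have h1 := (T.mapsTo i (x := (1, 0)) (by simp [sq])).1
  simp only [mem_Icc] at h0 h1
  rw [h, abs_le]
  constructor <;> linarith [h0.1, h0.2, h1.1, h1.2]

lemma exists_domination : ∃ d > (0 : ℝ), ∃ η : ℝ, 0 ≤ η ∧ η < 1 ∧ ∀ i, ∀ a ∈ sq,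
    d ≤ |T.gy i a| ∧ |T.gy i a| ≤ 1 ∧ ∀ x ∈ Icc (0 : ℝ) 1, |T.gy i a| ≤ η * |T.fx i x| := by
  obtain ⟨d, hd, hdom⟩ := T.domination
  obtain ⟨M, hM0, hM⟩ := exists_partials_le T
  set s : I → ℝ := fun i => sSup ((fun a => |T.gy i a|) '' sq)
  set e : I → ℝ := fun i => sInf ((fun x => |T.fx i x|) '' Icc (0 : ℝ) 1)
  have hs : ∀ i, ∀ a ∈ sq, |T.gy i a| ≤ s i := fun i a ha =>
    le_csSup ⟨M, by rintro _ ⟨b, hb, rfl⟩; exact (hM i b hb).2⟩ ⟨a, ha, rfl⟩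
  have hdl : ∀ i, ∀ a ∈ sq, d ≤ |T.gy i a| := fun i a ha => (hdom i).1.trans
    (csInf_le ⟨0, by rintro _ ⟨b, hb, rfl⟩; exact abs_nonneg _⟩ ⟨a, ha, rfl⟩)
  have he : ∀ i, ∀ x ∈ Icc (0 : ℝ) 1, e i ≤ |T.fx i x| := fun i x hx =>
    csInf_le ⟨0, by rintro _ ⟨b, hb, rfl⟩; exact abs_nonneg _⟩ ⟨x, hx, rfl⟩
  have hs0 : ∀ i, 0 < s i := fun i =>
    hd.trans_le ((hdl i 0 zero_mem_sq).trans (hs i 0 zero_mem_sq))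
  have hse : ∀ i, s i < e i := fun i => (hdom i).2
  have he0 : ∀ i, 0 < e i := fun i => (hs0 i).trans (hse i)
  have := T.nonempty_index
  obtain ⟨i₀, hi₀⟩ := Finite.exists_max fun i => s i / e i
  refine ⟨d, hd, s i₀ / e i₀, div_nonneg (hs0 _).le (he0 _).le,
    (div_lt_one (he0 _)).2 (hse _), fun i a ha => ⟨hdl i a ha, ?_, fun x hx => ?_⟩⟩
  · obtain ⟨x, hx, hx1⟩ := exists_abs_fx_le_one T i
    linarith [hs i a ha, hse i, he i x hx]
  · calc |T.gy i a| ≤ s i := hs i a ha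
      _ = s i / e i * e i := by rw [div_mul_cancel₀ _ (he0 i).ne']
      _ ≤ _ := mul_le_mul (hi₀ i) (he i x hx) (he0 i).le
        (div_nonneg (hs0 _).le (he0 _).le)

/-- Bounded distortion for the multiplicative cocycle generated by Hölder functions that are
bounded away from zero. -/
lemma exists_distortion (φ : I → ℝ × ℝ → ℝ) (P : List I → ℝ × ℝ → ℝ)
    (hnil : ∀ a, P [] a = 1) (hcons : ∀ i w a, P (i :: w) a = φ i (Sw T w a) * P w a)
    {d : ℝ} (hd : 0 < d) (hφd : ∀ i, ∀ a ∈ sq, d ≤ |φ i a|) {α H : ℝ} (hα : 0 < α) (hH : 0 < H)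
    (hφ : ∀ i, ∀ a ∈ sq, ∀ b ∈ sq, |φ i a - φ i b| ≤ H * dE a b ^ α) :
    ∃ K : ℝ, 1 ≤ K ∧ ∀ w, ∀ a ∈ sq, ∀ b ∈ sq, |P w a| ≤ K * |P w b| := by
  obtain ⟨c, hc0, hc1, hc⟩ := exists_dE_Sw_le T
  set q : ℝ := c ^ α
  have hq0 : 0 ≤ q := by positivity
  have hq1 : q < 1 := Real.rpow_lt_one hc0.le hc1 hα
  set D : ℝ := H * 2 ^ α / d
  have hD : 0 ≤ D := by positivity
  have hstep : ∀ w, ∀ a ∈ sq, ∀ b ∈ sq,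
      |P w a| ≤ Real.exp (D * ∑ k ∈ Finset.range w.length, q ^ k) * |P w b| := by
    intro w a ha b hb
    induction w with
    | nil => simp [hnil]
    | cons i w ih =>
      have ha' := Sw_mem_sq T w ha
      have hb' := Sw_mem_sq T w hb
      have h1 : |φ i (Sw T w a)| ≤ Real.exp (D * q ^ w.length) * |φ i (Sw T w b)| := by
        have e1 : H * dE (Sw T w a) (Sw T w b) ^ α ≤ d * (D * q ^ w.length) := by
          have e2 : dE (Sw T w a) (Sw T w b) ≤ c ^ w.length * 2 :=
            (hc w a ha b hb).trans (by gcongr; exact dE_le_two ha hb)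
          have e3 : (c ^ w.length * 2) ^ α = q ^ w.length * 2 ^ α := by
            rw [Real.mul_rpow (by positivity) (by norm_num), ← Real.rpow_natCast,
              ← Real.rpow_mul hc0.le, mul_comm (w.length : ℝ), Real.rpow_mul hc0.le,
              Real.rpow_natCast]
          calc H * dE (Sw T w a) (Sw T w b) ^ α ≤ H * (c ^ w.length * 2) ^ α := by
                gcongr
                exact dE_nonneg _ _
            _ = _ := by rw [e3]; simp only [D]; field_simp
        have e4 := (abs_sub_abs_le_abs_sub _ _).trans ((hφ i _ ha' _ hb').trans e1)
        have e5 := hφd i _ hb'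
        have e6 := Real.add_one_le_exp (D * q ^ w.length)
        have e7 : 0 ≤ D * q ^ w.length := by positivity
        nlinarith [mul_le_mul_of_nonneg_right e5 e7,
          mul_le_mul_of_nonneg_right e6 (abs_nonneg (φ i (Sw T w b)))]
      rw [hcons, hcons, abs_mul, abs_mul, List.length_cons, Finset.sum_range_succ, mul_add,
        Real.exp_add]
      calc _ ≤ (Real.exp (D * q ^ w.length) * |φ i (Sw T w b)|) *
            (Real.exp (D * ∑ k ∈ Finset.range w.length, q ^ k) * |P w b|) := by gcongr
        _ = _ := by ring
  refine ⟨Real.exp (D * (1 - q)⁻¹), Real.one_le_exp ?_, fun w a ha b hb =>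
    (hstep w a ha b hb).trans ?_⟩
  · have : 0 < 1 - q := by linarith
    positivity
  · gcongr
    rw [← tsum_geometric_of_lt_one hq0 hq1]
    exact (summable_geometric_of_lt_one hq0 hq1).sum_le_tsum _ fun k _ => by positivity

lemma exists_distortion_gyw :
    ∃ K : ℝ, 1 ≤ K ∧ ∀ w, ∀ a ∈ sq, ∀ b ∈ sq, |gyw T w a| ≤ K * |gyw T w b| := by
  obtain ⟨d, hd, η, hη0, hη1, hdom⟩ := exists_domination T
  obtain ⟨α, hα, H, hH, hh⟩ := T.holder
  exact exists_distortion T T.gy (gyw T) (fun _ => rfl) (fun _ _ _ => rfl) hd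
    (fun i a ha => (hdom i a ha).1) hα hH fun i => (hh i).2.2

lemma exists_distortion_fxw :
    ∃ K : ℝ, 1 ≤ K ∧ ∀ w, ∀ a ∈ sq, ∀ b ∈ sq, |fxw T w a| ≤ K * |fxw T w b| := by
  obtain ⟨d, hd, η, hη0, hη1, hdom⟩ := exists_domination T
  obtain ⟨α, hα, H, hH, hh⟩ := T.holder
  refine exists_distortion T (fun i a => T.fx i a.1) (fxw T) (fun _ => rfl) (fun _ _ _ => rfl) hd
    (fun i a ha => ?_) hα hH fun i a ha b hb => ?_
  · obtain ⟨h1, -, h3⟩ := hdom i a ha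
    nlinarith [h3 _ ha.1, abs_nonneg (T.fx i a.1)]
  · refine ((hh i).1 _ ha.1 _ hb.1).trans ?_
    gcongr
    exact abs_fst_sub_le_dE a b

lemma exists_gxw_le : ∃ C : ℝ, 0 ≤ C ∧ ∀ w, ∀ a ∈ sq, |gxw T w a| ≤ C * |fxw T w a| := by
  obtain ⟨d, hd, η, hη0, hη1, hdom⟩ := exists_domination T
  obtain ⟨M, hM0, hM⟩ := exists_partials_le T
  have h1η : 0 < 1 - η := by linarith
  refine ⟨M / d / (1 - η), by positivity, fun w a ha => ?_⟩
  set C := M / d / (1 - η) with hC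
  have hCM : M = C * (1 - η) * d := by rw [hC]; field_simp
  have hC0 : 0 ≤ C := by positivity
  induction w with
  | nil => simp [gxw, fxw, hC0]
  | cons i w ih =>
    have ha' := Sw_mem_sq T w ha
    obtain ⟨h1, -, h3⟩ := hdom i _ ha'
    have h3 := h3 _ ha'.1
    have h4 : d ≤ |T.fx i (Sw T w a).1| := by nlinarith [abs_nonneg (T.fx i (Sw T w a).1)]
    have h5 := (hM i _ ha').1
    have h6 : |T.gx i (Sw T w a)| ≤ C * (1 - η) * |T.fx i (Sw T w a).1| :=
      h5.trans (hCM.le.trans (by gcongr))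
    rw [gxw, fxw, abs_mul]
    calc |T.gx i (Sw T w a) * fxw T w a + T.gy i (Sw T w a) * gxw T w a|
        ≤ |T.gx i (Sw T w a)| * |fxw T w a| + |T.gy i (Sw T w a)| * |gxw T w a| := by
          rw [← abs_mul, ← abs_mul]; exact abs_add_le _ _
      _ ≤ (C * (1 - η) * |T.fx i (Sw T w a).1|) * |fxw T w a| +
          (η * |T.fx i (Sw T w a).1|) * (C * |fxw T w a|) := by gcongr
      _ = _ := by ring

lemma gyw_bounds (w : List I) {a : ℝ × ℝ} (ha : a ∈ sq) :
    0 < |gyw T w a| ∧ |gyw T w a| ≤ 1 ∧ |gyw T w a| ≤ |fxw T w a| := by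
  obtain ⟨d, hd, η, hη0, hη1, hdom⟩ := exists_domination T
  induction w with
  | nil => simp [gyw, fxw]
  | cons i w ih =>
    have ha' := Sw_mem_sq T w ha
    obtain ⟨h1, h2, h3⟩ := hdom i _ ha'
    have h3 := h3 _ ha'.1
    have h4 : |T.gy i (Sw T w a)| ≤ |T.fx i (Sw T w a).1| := by
      nlinarith [abs_nonneg (T.fx i (Sw T w a).1)]
    rw [gyw, fxw, abs_mul, abs_mul]
    exact ⟨mul_pos (hd.trans_le h1) ih.1, mul_le_one₀ h2 (abs_nonneg _) ih.2.1, by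
      exact mul_le_mul h4 ih.2.2 (abs_nonneg _) (abs_nonneg _)⟩

lemma hasFDerivWithinAt_Sw (w : List I) {a : ℝ × ℝ} (ha : a ∈ sq) :
    HasFDerivWithinAt (fun b => (Sw T w b).1)
      (fxw T w a • ContinuousLinearMap.fst ℝ ℝ ℝ) sq a ∧
    HasFDerivWithinAt (fun b => (Sw T w b).2)
      (gxw T w a • ContinuousLinearMap.fst ℝ ℝ ℝ +
        gyw T w a • ContinuousLinearMap.snd ℝ ℝ ℝ) sq a := by
  induction w with
  | nil =>
    simp only [Sw, fxw, gxw, gyw, one_smul, zero_smul, zero_add]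
    exact ⟨hasFDerivWithinAt_fst, hasFDerivWithinAt_snd⟩
  | cons i w ih =>
    have ha' := Sw_mem_sq T w ha
    have hmaps : MapsTo (Sw T w) sq sq := fun b hb => Sw_mem_sq T w hb
    constructor
    · refine ((T.hasDeriv_f i _ ha'.1).comp_hasFDerivWithinAt a ih.1
        fun b hb => (Sw_mem_sq T w hb).1).congr_fderiv ?_
      rw [fxw, smul_smul]
    · have hS : HasFDerivWithinAt (Sw T w) _ sq a := ih.1.prodMk ih.2
      refine ((T.hasDeriv_g i _ ha').comp a hS hmaps).congr_fderiv ?_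
      ext <;> simp [gxw, gyw]

lemma continuousOn_Sw (w : List I) : ContinuousOn (Sw T w) sq := fun _ ha =>
  ((hasFDerivWithinAt_Sw T w ha).1.prodMk (hasFDerivWithinAt_Sw T w ha).2).continuousWithinAt

lemma exists_fst_Sw_sub (w : List I) {a b : ℝ × ℝ} (ha : a ∈ sq) (hb : b ∈ sq) :
    ∃ z ∈ sq, (Sw T w a).1 - (Sw T w b).1 = fxw T w z * (a.1 - b.1) := by
  obtain ⟨z, hz, h⟩ := domain_mvt (fun z hz => (hasFDerivWithinAt_Sw T w hz).1) convex_sq hb ha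
  exact ⟨z, convex_sq.segment_subset hb ha hz, by simpa using h⟩

lemma exists_snd_Sw_sub (w : List I) {a b : ℝ × ℝ} (ha : a ∈ sq) (hb : b ∈ sq) :
    ∃ z ∈ sq, (Sw T w a).2 - (Sw T w b).2 =
      gxw T w z * (a.1 - b.1) + gyw T w z * (a.2 - b.2) := by
  obtain ⟨z, hz, h⟩ := domain_mvt (fun z hz => (hasFDerivWithinAt_Sw T w hz).2) convex_sq hb ha
  exact ⟨z, convex_sq.segment_subset hb ha hz, by simpa using h⟩

lemma exists_fxw_mul_le : ∃ K : ℝ, 0 < K ∧ ∀ w, ∀ p ∈ sq, ∀ a ∈ sq, ∀ b ∈ sq,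
    |fxw T w p| * |a.1 - b.1| ≤ K * |(Sw T w a).1 - (Sw T w b).1| := by
  obtain ⟨K, hK1, hK⟩ := exists_distortion_fxw T
  refine ⟨K, by linarith, fun w p hp a ha b hb => ?_⟩
  obtain ⟨z, hz, h⟩ := exists_fst_Sw_sub T w ha hb
  rw [h, abs_mul, ← mul_assoc]
  gcongr
  exact hK w p hp z hz

/-- `S_w` contracts Euclidean distances at most by a factor comparable to `|g_{w,y}|`. -/
lemma exists_gyw_mul_dE_le : ∃ C : ℝ, 0 < C ∧ ∀ w, ∀ p ∈ sq, ∀ a ∈ sq, ∀ b ∈ sq,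
    |gyw T w p| * dE a b ≤ C * dE (Sw T w a) (Sw T w b) := by
  obtain ⟨K₁, hK₁, h1⟩ := exists_fxw_mul_le T
  obtain ⟨K₂, hK₂1, h2⟩ := exists_distortion_gyw T
  obtain ⟨C, hC, h3⟩ := exists_gxw_le T
  refine ⟨K₁ + K₂ * (1 + C * K₁), by positivity, fun w p hp a ha b hb => ?_⟩
  have e1 : |gyw T w p| * |a.1 - b.1| ≤ K₁ * dE (Sw T w a) (Sw T w b) :=
    calc _ ≤ |fxw T w p| * |a.1 - b.1| :=
        mul_le_mul_of_nonneg_right (gyw_bounds T w hp).2.2 (abs_nonneg _)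
      _ ≤ K₁ * |(Sw T w a).1 - (Sw T w b).1| := h1 w p hp a ha b hb
      _ ≤ _ := by gcongr; exact abs_fst_sub_le_dE _ _
  obtain ⟨z, hz, h⟩ := exists_snd_Sw_sub T w ha hb
  have e2 : |gyw T w p| * |a.2 - b.2| ≤ K₂ * ((1 + C * K₁) * dE (Sw T w a) (Sw T w b)) :=
    calc _ ≤ K₂ * |gyw T w z| * |a.2 - b.2| := by gcongr; exact h2 w p hp z hz
      _ = K₂ * |((Sw T w a).2 - (Sw T w b).2) - gxw T w z * (a.1 - b.1)| := by
        rw [h, add_sub_cancel_left, abs_mul]; ring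
      _ ≤ K₂ * (|(Sw T w a).2 - (Sw T w b).2| + |gxw T w z| * |a.1 - b.1|) := by
        gcongr
        rw [← abs_mul]
        exact abs_sub _ _
      _ ≤ K₂ * (dE (Sw T w a) (Sw T w b) + C * (K₁ * dE (Sw T w a) (Sw T w b))) := by
        refine mul_le_mul_of_nonneg_left (add_le_add (abs_snd_sub_le_dE _ _) ?_) (by linarith)
        calc |gxw T w z| * |a.1 - b.1| ≤ C * |fxw T w z| * |a.1 - b.1| := by
              gcongr; exact h3 w z hz
          _ = C * (|fxw T w z| * |a.1 - b.1|) := by ring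
          _ ≤ C * (K₁ * |(Sw T w a).1 - (Sw T w b).1|) :=
              mul_le_mul_of_nonneg_left (h1 w z hz a ha b hb) hC
          _ ≤ _ := by gcongr; exact abs_fst_sub_le_dE _ _
      _ = _ := by ring
  calc |gyw T w p| * dE a b ≤ |gyw T w p| * (|a.1 - b.1| + |a.2 - b.2|) := by
        gcongr; exact dE_le_abs_add_abs a b
    _ ≤ _ := by linarith

end Geometry

section SingularValues

variable {I : Type} [Fintype I] (T : System I)

lemma sv_bounds (A : Matrix (Fin 2) (Fin 2) ℝ) (hA : 2 * |A.det| ≤ frobSq A) :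
    sv1 A ^ 2 ≤ frobSq A ∧ frobSq A ≤ 2 * sv1 A ^ 2 ∧ sv1 A ^ 2 * sv2 A ^ 2 = A.det ^ 2 := by
  have h0 : 0 ≤ frobSq A := le_trans (by positivity) hA
  have hD : 0 ≤ frobSq A ^ 2 - 4 * A.det ^ 2 := by
    nlinarith [sq_abs A.det, abs_nonneg A.det]
  set R := Real.sqrt (frobSq A ^ 2 - 4 * A.det ^ 2) with hR
  have hR0 : 0 ≤ R := Real.sqrt_nonneg _
  have hR2 : R ^ 2 = frobSq A ^ 2 - 4 * A.det ^ 2 := Real.sq_sqrt hD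
  have hRF : R ≤ frobSq A := Real.sqrt_le_iff.2 ⟨h0, by nlinarith [sq_nonneg A.det]⟩
  have e1 : sv1 A ^ 2 = (frobSq A + R) / 2 := Real.sq_sqrt (by positivity)
  have e2 : sv2 A ^ 2 = (frobSq A - R) / 2 := Real.sq_sqrt (by linarith)
  rw [e1, e2]
  exact ⟨by linarith, by linarith, by nlinarith⟩

lemma exists_alpha_le : ∃ C : ℝ, 0 < C ∧ ∀ w, ∀ a ∈ sq, 0 < alpha1 T w a ∧ 0 < alpha2 T w a ∧
    alpha1 T w a ≤ C * |fxw T w a| ∧ alpha2 T w a ≤ C * |gyw T w a| := by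
  obtain ⟨C, hC, hgx⟩ := exists_gxw_le T
  refine ⟨C + 2, by positivity, fun w a ha => ?_⟩
  obtain ⟨hg0, -, hgf⟩ := gyw_bounds T w ha
  have hf0 := hg0.trans_le hgf
  have hgx := hgx w a ha
  have hF : frobSq (Dmat T w a) = |fxw T w a| ^ 2 + |gxw T w a| ^ 2 + |gyw T w a| ^ 2 := by
    simp [frobSq, Dmat, Fin.sum_univ_two]
    ring
  have hdet : |(Dmat T w a).det| = |fxw T w a| * |gyw T w a| := by
    simp [Dmat, Matrix.det_fin_two, abs_mul]
  obtain ⟨h1, h2, h3⟩ := sv_bounds (Dmat T w a) (by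
    rw [hF, hdet]; nlinarith [sq_nonneg (|fxw T w a| - |gyw T w a|), sq_nonneg |gxw T w a|])
  change alpha1 T w a ^ 2 ≤ _ at h1
  change _ ≤ 2 * alpha1 T w a ^ 2 at h2
  change alpha1 T w a ^ 2 * alpha2 T w a ^ 2 = _ at h3
  have a1 : 0 ≤ alpha1 T w a := Real.sqrt_nonneg _
  have a2 : 0 ≤ alpha2 T w a := Real.sqrt_nonneg _
  rw [← sq_abs (Dmat T w a).det, hdet, ← mul_pow] at h3
  have h4 : alpha1 T w a * alpha2 T w a = |fxw T w a| * |gyw T w a| :=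
    (pow_left_inj₀ (by positivity) (by positivity) two_ne_zero).1 h3
  have hpos : 0 < alpha1 T w a * alpha2 T w a := by rw [h4]; positivity
  have p1 : 0 < alpha1 T w a := pos_of_mul_pos_left hpos a2
  have p2 : 0 < alpha2 T w a := pos_of_mul_pos_right hpos a1
  have h5 : |fxw T w a| ≤ 2 * alpha1 T w a := by
    refine (pow_le_pow_iff_left₀ (abs_nonneg _) (by positivity) two_ne_zero).1 ?_
    nlinarith [sq_nonneg |gxw T w a|, sq_nonneg |gyw T w a|]
  refine ⟨p1, p2, ?_, ?_⟩
  · refine (pow_le_pow_iff_left₀ a1 (by positivity) two_ne_zero).1 ?_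
    nlinarith [mul_self_le_mul_self (abs_nonneg _) hgx, mul_self_le_mul_self hg0.le hgf,
      mul_pos hf0 hf0, mul_nonneg hC (mul_pos hf0 hf0).le]
  · have : alpha1 T w a * alpha2 T w a ≤ alpha1 T w a * (2 * |gyw T w a|) := by
      rw [h4]; nlinarith
    have := le_of_mul_le_mul_left this p1
    nlinarith

end SingularValues

section Coding

variable {I : Type}

lemma length_word (ii : ℕ → I) (n : ℕ) : (word ii n).length = n := List.length_ofFn

lemma word_eq_word_iff {ii jj : ℕ → I} {n : ℕ} :
    word jj n = word ii n ↔ ∀ k < n, jj k = ii k := by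
  rw [word, word, List.ofFn_inj, funext_iff, Fin.forall_iff]

lemma word_add (ii : ℕ → I) (n k : ℕ) : word ii (n + k) = word ii n ++ word (shiftn ii n) k := by
  rw [word, List.ofFn_add]
  congr 1
  simp [word, shiftn, add_comm]

lemma mem_cyl_iff {w : List I} {jj : ℕ → I} : jj ∈ cyl w ↔ word jj w.length = w := by
  constructor
  · intro h
    refine List.ext_get (length_word jj _) fun k h1 h2 => ?_
    rw [← h ⟨k, h2⟩]
    simp [word]
  · intro h k
    rw [List.get_of_eq h.symm k]
    simp [word]

lemma mem_cyl_word_iff {ii jj : ℕ → I} {n : ℕ} :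
    jj ∈ cyl (word ii n) ↔ word jj n = word ii n := by
  rw [mem_cyl_iff, length_word]

lemma mem_cyl_append {w v : List I} {jj : ℕ → I} (hw : jj ∈ cyl w)
    (hv : shiftn jj w.length ∈ cyl v) : jj ∈ cyl (w ++ v) := by
  rw [mem_cyl_iff] at hw hv ⊢
  rw [List.length_append, word_add, hw, hv]

lemma iterate_shift (n : ℕ) (ii : ℕ → I) : shift^[n] ii = shiftn ii n := by
  induction n generalizing ii with
  | zero => rfl
  | succ n ih =>
    rw [Function.iterate_succ_apply, ih]
    funext k
    simp only [shift, shiftn]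
    congr 1

variable [Fintype I] {T : System I} {Pi : (ℕ → I) → ℝ × ℝ} {F : Set (ℝ × ℝ)}

lemma IsCoding.mem_sq (hPi : IsCoding T Pi) (ii : ℕ → I) : Pi ii ∈ sq := by
  obtain ⟨a, ha, h⟩ := hPi ii 0
  rw [← h]
  exact Sw_mem_sq T _ ha

lemma eq_of_forall_dE_le {a b : ℝ × ℝ} {c : ℝ} (hc0 : 0 < c) (hc1 : c < 1)
    (h : ∀ k : ℕ, dE a b ≤ c ^ k * 2) : a = b := by
  have h1 : Tendsto (fun k : ℕ => c ^ k * 2) atTop (nhds 0) := by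
    simpa using (tendsto_pow_atTop_nhds_zero_of_lt_one hc0.le hc1).mul_const 2
  exact dist_le_zero.1 ((dist_le_dE a b).trans (ge_of_tendsto' h1 h))

lemma IsCoding.eq_Sw (hPi : IsCoding T Pi) (ii : ℕ → I) (n : ℕ) :
    Pi ii = Sw T (word ii n) (Pi (shiftn ii n)) := by
  obtain ⟨c, hc0, hc1, hc⟩ := exists_dE_Sw_le T
  refine eq_of_forall_dE_le hc0 hc1 fun k => ?_
  obtain ⟨a, ha, h1⟩ := hPi ii (n + k)
  obtain ⟨b, hb, h2⟩ := hPi (shiftn ii n) k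
  rw [← h1, ← h2, ← Sw_append, ← word_add]
  calc _ ≤ c ^ (word ii (n + k)).length * dE a b := hc _ a ha b hb
    _ ≤ c ^ k * 2 := by
      rw [length_word]
      exact mul_le_mul (pow_le_pow_of_le_one hc0.le hc1.le (by omega)) (dE_le_two ha hb)
        (dE_nonneg _ _) (by positivity)

lemma IsAttractor.Sw_mem (hF : IsAttractor T F) (w : List I) {z : ℝ × ℝ} (hz : z ∈ F) :
    Sw T w z ∈ F := by
  induction w with
  | nil => exact hz
  | cons i w ih =>
    rw [hF.2.2.2]
    exact mem_iUnion.2 ⟨i, _, ih, rfl⟩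

lemma IsCoding.mem_attractor (hPi : IsCoding T Pi) (hF : IsAttractor T F) (ii : ℕ → I) :
    Pi ii ∈ F := by
  obtain ⟨c, hc0, hc1, hc⟩ := exists_dE_Sw_le T
  obtain ⟨z, hz⟩ := hF.1
  have hz' := hF.2.2.1 hz
  refine hF.2.1.isClosed.mem_of_tendsto (f := fun k => Sw T (word ii k) z) (b := atTop) ?_
    (Eventually.of_forall fun k => hF.Sw_mem _ hz)
  rw [tendsto_iff_dist_tendsto_zero]
  have h1 : Tendsto (fun k : ℕ => c ^ k * 2) atTop (nhds 0) := by
    simpa using (tendsto_pow_atTop_nhds_zero_of_lt_one hc0.le hc1).mul_const 2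
  refine squeeze_zero (fun _ => dist_nonneg) (fun k => ?_) h1
  obtain ⟨a, ha, h⟩ := hPi ii k
  rw [← h]
  refine (dist_le_dE _ _).trans ((hc _ z hz' a ha).trans ?_)
  rw [length_word]
  gcongr
  exact dE_le_two hz' ha

lemma IsCoding.mem_image_S (hPi : IsCoding T Pi) (hF : IsAttractor T F) (ii : ℕ → I) :
    Pi ii ∈ S T (ii 0) '' F :=
  ⟨Pi (shiftn ii 1), hPi.mem_attractor hF _, by simpa [word, Sw] using (hPi.eq_Sw ii 1).symm⟩

lemma IsAttractor.isCompact_image_S (hF : IsAttractor T F) (i : I) : IsCompact (S T i '' F) :=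
  hF.2.1.image_of_continuousOn ((continuousOn_Sw T [i]).mono hF.2.2.1)

lemma SSC.exists_le_dist (hSSC : SSC T F) (hF : IsAttractor T F) :
    ∃ δ > (0 : ℝ), ∀ i j, i ≠ j → ∀ a ∈ S T i '' F, ∀ b ∈ S T j '' F, δ ≤ dist a b := by
  have h : ∀ p : I × I, ∃ δ > (0 : ℝ), p.1 ≠ p.2 →
      ∀ a ∈ S T p.1 '' F, ∀ b ∈ S T p.2 '' F, δ ≤ dist a b := by
    intro p
    by_cases hp : p.1 = p.2
    · exact ⟨1, one_pos, fun h => absurd hp h⟩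
    · obtain ⟨r, hr0, hr⟩ := Metric.exists_pos_forall_lt_edist (hF.isCompact_image_S p.1)
        (hF.isCompact_image_S p.2).isClosed (hSSC _ _ hp)
      refine ⟨r, hr0, fun _ a ha b hb => ?_⟩
      have := hr a ha b hb
      rw [edist_nndist, ENNReal.coe_lt_coe] at this
      exact this.le
  choose δ hδ0 hδ using h
  have := T.nonempty_index
  obtain ⟨p, hp⟩ := Finite.exists_min δ
  exact ⟨δ p, hδ0 p, fun i j hij a ha b hb => (hp (i, j)).trans (hδ (i, j) hij a ha b hb)⟩

/-- A point of the attractor close to `Π(i)`, relative to the contraction of `S_{i|n}`, has the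
same first `n` symbols. -/
lemma IsCoding.exists_word_eq (hPi : IsCoding T Pi) (hF : IsAttractor T F) (hSSC : SSC T F) :
    ∃ κ > (0 : ℝ), ∀ (ii jj : ℕ → I) (n : ℕ), ∀ p ∈ sq,
      dE (Pi ii) (Pi jj) < κ * |gyw T (word ii n) p| → word jj n = word ii n := by
  obtain ⟨δ, hδ0, hδ⟩ := hSSC.exists_le_dist hF
  obtain ⟨C, hC0, hC⟩ := exists_gyw_mul_dE_le T
  refine ⟨δ / C, by positivity, fun ii jj n p hp hlt => ?_⟩
  have key : ∀ k ≤ n, word jj k = word ii k := by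
    intro k
    induction k with
    | zero => exact fun _ => rfl
    | succ k ih =>
      intro hk
      have hu := ih (Nat.le_of_succ_le hk)
      by_contra hne
      have hk' : ii k ≠ jj k := by
        intro hk'
        refine hne (word_eq_word_iff.2 fun l hl => ?_)
        rcases Nat.lt_succ_iff_lt_or_eq.1 hl with hl | rfl
        · exact word_eq_word_iff.1 hu l hl
        · exact hk'.symm
      have hi := hPi.mem_image_S hF (shiftn ii k)
      have hj := hPi.mem_image_S hF (shiftn jj k)
      simp only [shiftn, zero_add] at hi hj
      have hd := (hδ _ _ hk' _ hi _ hj).trans (dist_le_dE _ _)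
      obtain ⟨l, rfl⟩ := Nat.exists_eq_add_of_le (Nat.le_of_succ_le hk)
      set q := Sw T (word (shiftn ii k) l) p
      have hq : q ∈ sq := Sw_mem_sq T _ hp
      have h1 := hC (word ii k) q hq _ (hPi.mem_sq (shiftn ii k)) _ (hPi.mem_sq (shiftn jj k))
      rw [← hPi.eq_Sw ii k, ← hu, ← hPi.eq_Sw jj k, hu] at h1
      have h2 : |gyw T (word ii (k + l)) p| ≤ |gyw T (word ii k) q| := by
        rw [word_add, gyw_append, abs_mul]
        exact mul_le_of_le_one_right (abs_nonneg _) (gyw_bounds T _ hp).2.1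
      have h3 : |gyw T (word ii k) q| * δ ≤ C * dE (Pi ii) (Pi jj) :=
        le_trans (by gcongr) h1
      have h4 : C * dE (Pi ii) (Pi jj) < |gyw T (word ii (k + l)) p| * δ := by
        calc _ < C * (δ / C * |gyw T (word ii (k + l)) p|) := by gcongr
          _ = _ := by field_simp
      nlinarith
  exact key n le_rfl

end Coding

section CodingMeasure

variable {I : Type} [Fintype I] [MeasurableSpace I] {T : System I} {Pi : (ℕ → I) → ℝ × ℝ}
  {F : Set (ℝ × ℝ)}

lemma IsCoding.measurableSet_cyl (hPi : IsCoding T Pi) (hPim : Measurable Pi)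
    (hF : IsAttractor T F) (hSSC : SSC T F) (hs : Measurable (shift : (ℕ → I) → ℕ → I))
    (w : List I) : MeasurableSet (cyl w) := by
  have h0 : ∀ i : I, MeasurableSet {ii : ℕ → I | ii 0 = i} := by
    intro i
    have : {ii : ℕ → I | ii 0 = i} = Pi ⁻¹' (S T i '' F) := by
      ext ii
      have hi := hPi.mem_image_S hF ii
      constructor
      · rintro rfl
        exact hi
      · intro h
        by_contra hne
        exact disjoint_left.1 (hSSC _ _ hne) hi h
    rw [this]
    exact hPim (hF.isCompact_image_S i).measurableSet
  have : cyl w = ⋂ k : Fin w.length, shift^[k.1] ⁻¹' {ii : ℕ → I | ii 0 = w.get k} := by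
    ext jj
    simp [cyl, iterate_shift, shiftn]
  rw [this]
  exact MeasurableSet.iInter fun k => hs.iterate _ (h0 _)

variable {m : Measure (ℕ → I)} [IsProbabilityMeasure m]

/-- Quasi-Bernoulli upper bound for the part of a cylinder whose tail is coded into a
vertical strip. -/
lemma IsCoding.measureReal_cyl_inter_le (hPi : IsCoding T Pi) (hPim : Measurable Pi)
    (hF : IsAttractor T F) (hSSC : SSC T F) (hs : Measurable (shift : (ℕ → I) → ℕ → I))
    {L : ℝ} (hQB : QuasiBernoulli m L) (w : List I) (z : ℝ) {ρ : ℝ} (hρ : 0 < ρ) :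
    m.real {jj | jj ∈ cyl w ∧ |(Pi (shiftn jj w.length)).1 - z| ≤ ρ} ≤
      L * m.real (cyl w) * ((m.map Pi).map Prod.fst).real (Metric.closedBall z (2 * ρ)) := by
  classical
  obtain ⟨c, hc0, hc1, hc⟩ := exists_dE_Sw_le T
  obtain ⟨N, hN⟩ : ∃ N : ℕ, c ^ N < ρ / 2 := exists_pow_lt_of_lt_one (by positivity) hc1
  set V : Finset (Fin N → I) :=
    Finset.univ.filter fun v => ∃ kk ∈ cyl (List.ofFn v), |(Pi kk).1 - z| ≤ ρ with hV
  have hcyl := hPi.measurableSet_cyl hPim hF hSSC hs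
  have hmem : ∀ kk : ℕ → I, kk ∈ cyl (List.ofFn fun k : Fin N => kk k) := fun kk => by
    rw [mem_cyl_iff, List.length_ofFn]; rfl
  have hmem' : ∀ (v : Fin N → I) (kk : ℕ → I), kk ∈ cyl (List.ofFn v) → word kk N = List.ofFn v :=
    fun v kk h => by
      rw [mem_cyl_iff, List.length_ofFn] at h
      exact h
  have hdisj : (V : Set (Fin N → I)).PairwiseDisjoint fun v => cyl (List.ofFn v) := by
    intro u _ v _ huv
    refine disjoint_left.2 fun kk hu hv => huv ?_
    exact List.ofFn_injective ((hmem' u kk hu).symm.trans (hmem' v kk hv))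
  have hsub : (⋃ v ∈ V, cyl (List.ofFn v)) ⊆
      Pi ⁻¹' (Prod.fst ⁻¹' (Metric.closedBall z (2 * ρ))) := by
    intro kk hkk
    simp only [mem_iUnion, exists_prop, hV, Finset.mem_filter, Finset.mem_univ, true_and] at hkk
    obtain ⟨v, ⟨jj, hjj, hjz⟩, hkv⟩ := hkk
    rw [mem_preimage, mem_preimage, Metric.mem_closedBall, Real.dist_eq]
    have h1 : dE (Pi kk) (Pi jj) ≤ ρ := by
      rw [hPi.eq_Sw kk N, hPi.eq_Sw jj N, hmem' v kk hkv, hmem' v jj hjj]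
      have h2 := hc (List.ofFn v) _ (hPi.mem_sq (shiftn kk N)) _ (hPi.mem_sq (shiftn jj N))
      have h3 := dE_le_two (hPi.mem_sq (shiftn kk N)) (hPi.mem_sq (shiftn jj N))
      rw [List.length_ofFn] at h2
      nlinarith [pow_pos hc0 N]
    have h4 := (abs_fst_sub_le_dE _ _).trans h1
    have h5 := abs_sub_le (Pi kk).1 (Pi jj).1 z
    linarith
  have hcover : {jj | jj ∈ cyl w ∧ |(Pi (shiftn jj w.length)).1 - z| ≤ ρ} ⊆
      ⋃ v ∈ V, cyl (w ++ List.ofFn v) := by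
    rintro jj ⟨h1, h2⟩
    refine mem_biUnion (x := fun k : Fin N => shiftn jj w.length k) ?_
      (mem_cyl_append h1 (hmem _))
    simp only [hV, Finset.coe_filter, Finset.mem_univ, true_and]
    exact ⟨_, hmem _, h2⟩
  have hL := hQB.1
  calc _ ≤ m.real (⋃ v ∈ V, cyl (w ++ List.ofFn v)) := measureReal_mono hcover (measure_ne_top m _)
    _ ≤ ∑ v ∈ V, m.real (cyl (w ++ List.ofFn v)) := measureReal_biUnion_finset_le _ _
    _ ≤ ∑ v ∈ V, L * m.real (cyl w) * m.real (cyl (List.ofFn v)) :=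
        Finset.sum_le_sum fun v _ => (hQB.2 w (List.ofFn v)).2
    _ = L * m.real (cyl w) * m.real (⋃ v ∈ V, cyl (List.ofFn v)) := by
        rw [← Finset.mul_sum, measureReal_biUnion_finset hdisj fun v _ => hcyl _]
    _ ≤ _ := by
        rw [map_measureReal_apply measurable_fst Metric.isClosed_closedBall.measurableSet,
          map_measureReal_apply hPim (measurable_fst Metric.isClosed_closedBall.measurableSet)]
        gcongr
        exact measure_ne_top m _

lemma ae_forall_measureReal_cyl_pos : ∀ᵐ ii ∂m, ∀ n, 0 < m.real (cyl (word ii n)) := by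
  rw [ae_all_iff]
  intro n
  have h : m (⋃ v ∈ {v : Fin n → I | m (cyl (List.ofFn v)) = 0}, cyl (List.ofFn v)) = 0 :=
    (measure_biUnion_null_iff (Set.to_countable _)).2 fun v hv => hv
  refine measure_mono_null (fun ii hii => ?_) h
  have hii : ¬ 0 < m.real (cyl (word ii n)) := hii
  have h0 : m.real (cyl (word ii n)) = 0 := le_antisymm (not_lt.1 hii) measureReal_nonneg
  rw [measureReal_eq_zero_iff] at h0
  exact mem_biUnion (x := fun k : Fin n => ii k) h0 (mem_cyl_word_iff.2 rfl)

/-- Upper bound for the measure of a ball through an approximate square of level `n`. -/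
lemma IsCoding.exists_measureReal_ballE_le (hPi : IsCoding T Pi) (hPim : Measurable Pi)
    (hF : IsAttractor T F) (hSSC : SSC T F) (hs : Measurable (shift : (ℕ → I) → ℕ → I))
    {L : ℝ} (hQB : QuasiBernoulli m L) :
    ∃ κ > (0 : ℝ), ∃ K > (0 : ℝ), ∀ (ii : ℕ → I) (n : ℕ) (r : ℝ),
      0 < r → r < κ * |gyw T (word ii n) (Pi (shiftn ii n))| →
      (m.map Pi).real (ballE (Pi ii) r) ≤ L * m.real (cyl (word ii n)) *
        ((m.map Pi).map Prod.fst).real (Metric.closedBall (Pi (shiftn ii n)).1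
          (K * r / |fxw T (word ii n) (Pi (shiftn ii n))|)) := by
  obtain ⟨κ, hκ, hsep⟩ := hPi.exists_word_eq hF hSSC
  obtain ⟨K, hK, hfx⟩ := exists_fxw_mul_le T
  refine ⟨κ, hκ, 2 * K, by positivity, fun ii n r hr hlt => ?_⟩
  have hp := hPi.mem_sq (shiftn ii n)
  set p := Pi (shiftn ii n) with hpdef
  have hf : 0 < |fxw T (word ii n) p| :=
    (gyw_bounds T _ hp).1.trans_le (gyw_bounds T _ hp).2.2
  rw [map_measureReal_apply hPim (measurableSet_ballE _ _)]
  have h := hPi.measureReal_cyl_inter_le hPim hF hSSC hs hQB (word ii n) p.1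
    (ρ := K * r / |fxw T (word ii n) p|) (by positivity)
  rw [show 2 * (K * r / |fxw T (word ii n) p|) = 2 * K * r / |fxw T (word ii n) p| by ring] at h
  refine le_trans (measureReal_mono fun jj hjj => ?_) h
  have hjj : dE (Pi ii) (Pi jj) ≤ r := hjj
  have hw := hsep ii jj n p hp (hjj.trans_lt hlt)
  refine ⟨mem_cyl_word_iff.2 hw, ?_⟩
  rw [length_word, le_div_iff₀ hf, mul_comm, abs_sub_comm]
  refine (hfx _ p hp _ hp _ (hPi.mem_sq (shiftn jj n))).trans ?_
  rw [← hPi.eq_Sw ii n, ← hw, ← hPi.eq_Sw jj n]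
  gcongr
  exact (abs_fst_sub_le_dE _ _).trans hjj

end CodingMeasure

section Asymptotics

lemma tendsto_log_const_mul_div {x : ℕ → ℝ} {χ c : ℝ} (hc : 0 < c) (hx : ∀ n, 0 < x n)
    (hlim : Tendsto (fun n : ℕ => Real.log (x n) / n) atTop (nhds χ)) :
    Tendsto (fun n : ℕ => Real.log (c * x n) / n) atTop (nhds χ) := by
  have h := (tendsto_const_div_atTop_nhds_zero_nat (Real.log c)).add hlim
  rw [zero_add] at h
  refine h.congr fun n => ?_
  rw [Real.log_mul hc.ne' (hx n).ne', add_div]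

lemma eventually_exp_le {x : ℕ → ℝ} {χ a : ℝ} (hx : ∀ n, 0 < x n)
    (hlim : Tendsto (fun n : ℕ => Real.log (x n) / n) atTop (nhds χ)) (ha : a < χ) :
    ∀ᶠ n : ℕ in atTop, Real.exp (n * a) ≤ x n := by
  filter_upwards [hlim.eventually_const_lt ha, eventually_gt_atTop 0] with n hn hn0
  rw [← Real.le_log_iff_exp_le (hx n), mul_comm]
  exact ((lt_div_iff₀ (by exact_mod_cast hn0)).1 hn).le

lemma eventually_le_exp {x : ℕ → ℝ} {χ a : ℝ} (hx : ∀ n, 0 < x n)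
    (hlim : Tendsto (fun n : ℕ => Real.log (x n) / n) atTop (nhds χ)) (ha : χ < a) :
    ∀ᶠ n : ℕ in atTop, x n ≤ Real.exp (n * a) := by
  filter_upwards [hlim.eventually_lt_const ha, eventually_gt_atTop 0] with n hn hn0
  rw [← Real.log_le_iff_le_exp (hx n), mul_comm]
  exact ((div_lt_iff₀ (by exact_mod_cast hn0)).1 hn).le

/-- A lower bound on the local scaling exponent of `M` from upper bounds along a sequence of
geometric scales having no large gaps. -/
lemma eventually_le_log_div_log {M : ℝ → ℝ} {good : ℕ → Prop} {ε b A s D : ℝ}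
    (hM : ∀ r > 0, 0 < M r)
    (hε : 0 < ε) (hε1 : ε < 1) (hb : b < 0) (hD : 0 < D)
    (hgood : ∀ n : ℕ, 1 ≤ n → ∃ k : ℕ, (1 - ε) * n ≤ k ∧ k ≤ n ∧ good k)
    (H : ∀ᶠ n : ℕ in atTop, good n → ∀ r, 0 < r → r ≤ Real.exp (n * b) →
      M r ≤ D * Real.exp (n * A) * r ^ s) :
    ∀ᶠ r in nhdsWithin (0 : ℝ) (Ioi 0),
      (A + ε * |A|) / b + s - ε ≤ Real.log (M r) / Real.log r := by
  obtain ⟨N, hN⟩ := eventually_atTop.1 H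
  set B := A + ε * |A| with hB
  set c₀ := Real.log D + |B|
  filter_upwards [self_mem_nhdsWithin,
    Real.tendsto_log_nhdsGT_zero.eventually_le_atBot (-1),
    Real.tendsto_log_nhdsGT_zero.eventually_le_atBot (b * ((N + 1) / (1 - ε) + 1)),
    Real.tendsto_log_nhdsGT_zero.eventually_le_atBot (-(|c₀| / ε))] with r hr0 hr1 hrN hrc
  have hr0 : 0 < r := hr0
  set ℓ := Real.log r with hℓ
  have h1ε : 0 < 1 - ε := by linarith
  have hx : (N + 1) / (1 - ε) + 1 ≤ ℓ / b := by
    rw [le_div_iff_of_neg hb]; linarith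
  have hx0 : 0 ≤ (N + 1 : ℝ) / (1 - ε) := by positivity
  have hfl := Nat.floor_le (show 0 ≤ ℓ / b by linarith)
  have hfl' := Nat.lt_floor_add_one (ℓ / b)
  set n := ⌊ℓ / b⌋₊
  have hnN : (N + 1) / (1 - ε) ≤ (n : ℝ) := by linarith
  have hnN' : (N + 1 : ℝ) ≤ (1 - ε) * n := by
    rw [div_le_iff₀ h1ε] at hnN; linarith
  have hn1 : 1 ≤ n := by
    by_contra hlt
    have : n = 0 := by omega
    rw [this] at hnN'
    have : (0 : ℝ) ≤ N := N.cast_nonneg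
    simp at hnN'
    linarith
  obtain ⟨k, hk1, hk2, hk⟩ := hgood n hn1
  have hk2' : (k : ℝ) ≤ n := by exact_mod_cast hk2
  have hkN : N ≤ k := by
    have : (N : ℝ) ≤ k := by linarith
    exact_mod_cast this
  have hrk : r ≤ Real.exp (k * b) := by
    rw [← Real.log_le_iff_le_exp hr0, ← hℓ]
    have : ℓ / b * b = ℓ := div_mul_cancel₀ _ hb.ne
    nlinarith
  have hle := hN k hkN hk r hr0 hrk
  have hlog : Real.log (M r) ≤ Real.log D + k * A + s * ℓ := by
    refine (Real.log_le_log (hM r hr0) hle).trans_eq ?_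
    rw [Real.log_mul (by positivity) (by positivity), Real.log_mul hD.ne' (Real.exp_pos _).ne',
      Real.log_exp, Real.log_rpow hr0]
  have hkA : k * A ≤ n * B := by
    have h1 : -(n - k) * A ≤ (n - k) * |A| := by
      nlinarith [neg_abs_le A]
    have h2 : (n - k : ℝ) * |A| ≤ ε * n * |A| :=
      mul_le_mul_of_nonneg_right (by linarith) (abs_nonneg A)
    rw [hB]
    linarith
  have hnB : n * B ≤ B / b * ℓ + |B| := by
    have h1 : B / b * ℓ = ℓ / b * B := by ring
    rw [h1]
    have h2 : (ℓ / b - n) * (-B) ≤ 1 * |B| := by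
      refine (mul_le_mul_of_nonneg_left (neg_le_abs B) (by linarith)).trans ?_
      exact mul_le_mul_of_nonneg_right (by linarith) (abs_nonneg B)
    linarith
  have hℓ0 : ℓ < 0 := by linarith
  rw [le_div_iff_of_neg hℓ0]
  have hc : c₀ ≤ -ε * ℓ := by
    have h1 : |c₀| / ε ≤ -ℓ := by linarith
    rw [div_le_iff₀ hε] at h1
    linarith [le_abs_self c₀]
  have : (B / b + s - ε) * ℓ = B / b * ℓ + s * ℓ + -ε * ℓ := by ring
  simp only [c₀] at hc
  linarith

/-- An upper bound on the local scaling exponent of `M` from lower bounds at geometric scales. -/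
lemma isCoboundedUnder_log_div_log {M : ℝ → ℝ} {c a : ℝ} (hc0 : 0 < c) (hc1 : c < 1)
    (ha : a < 0)
    (H : ∀ᶠ n : ℕ in atTop, ∀ r, c ^ n * 2 ≤ r → Real.exp (n * a) ≤ M r) :
    IsCoboundedUnder (· ≥ ·) (nhdsWithin (0 : ℝ) (Ioi 0))
      fun r => Real.log (M r) / Real.log r := by
  obtain ⟨N, hN⟩ := eventually_atTop.1 H
  have hlc : Real.log c < 0 := Real.log_neg hc0 hc1
  refine isCoboundedUnder_ge_of_eventually_le _ (x := 3 * a / Real.log c) ?_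
  filter_upwards [self_mem_nhdsWithin,
    Real.tendsto_log_nhdsGT_zero.eventually_le_atBot (-Real.log 2),
    Real.tendsto_log_nhdsGT_zero.eventually_le_atBot (Real.log c),
    Real.tendsto_log_nhdsGT_zero.eventually_le_atBot (N * Real.log c)] with r hr0 hr1 hr2 hr3
  have hr0 : 0 < r := hr0
  have hl2 : 0 < Real.log 2 := Real.log_pos one_lt_two
  set ℓ := Real.log r with hℓ
  have hx1 : 1 ≤ ℓ / Real.log c := by rw [le_div_iff_of_neg hlc]; linarith
  have hxN : (N : ℝ) ≤ ℓ / Real.log c := by rw [le_div_iff_of_neg hlc]; linarith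
  set x := (ℓ - Real.log 2) / Real.log c with hx
  have hxℓ : ℓ / Real.log c ≤ x := div_le_div_of_nonpos_of_le hlc.le (by linarith)
  have hxu : x ≤ 2 * (ℓ / Real.log c) := by
    rw [← mul_div_assoc]
    exact div_le_div_of_nonpos_of_le hlc.le (by linarith)
  have hn1 := Nat.le_ceil x
  have hn2 := Nat.ceil_lt_add_one (show 0 ≤ x by linarith)
  set n := ⌈x⌉₊
  have hnN : N ≤ n := by
    have : (N : ℝ) ≤ n := by linarith
    exact_mod_cast this
  have hcn : c ^ n * 2 ≤ r := by
    rw [← Real.log_le_log_iff (by positivity) hr0, Real.log_mul (by positivity) two_ne_zero,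
      Real.log_pow]
    have : x * Real.log c = ℓ - Real.log 2 := div_mul_cancel₀ _ hlc.ne
    nlinarith
  have hM := hN n hnN r hcn
  have hlog : n * a ≤ Real.log (M r) := by
    rw [Real.le_log_iff_exp_le ((Real.exp_pos _).trans_le hM)]
    exact hM
  rw [div_le_iff_of_neg (by linarith)]
  have : 3 * a / Real.log c * ℓ = 3 * (ℓ / Real.log c) * a := by ring
  rw [this]
  nlinarith

end Asymptotics

section Irregular

/-- The points at which `ν` fails the bound `ν(B(x, e⁻ᵏ)) ≤ C e⁻ᵏˢ` for some `k`. -/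
def irregularSet (ν : Measure ℝ) (s : ℝ) (C : ℕ) : Set ℝ :=
  {x | ∃ k : ℕ, C * Real.exp (-(k * s)) < ν.real (Metric.closedBall x (Real.exp (-k)))}

variable {ν : Measure ℝ} [IsProbabilityMeasure ν] {s : ℝ}

lemma measurableSet_irregularSet (C : ℕ) : MeasurableSet (irregularSet ν s C) := by
  have hball : ∀ ρ : ℝ, Measurable fun x => ν.real (Metric.closedBall x ρ) := by
    intro ρ
    have hcl : IsClosed {p : ℝ × ℝ | dist p.2 p.1 ≤ ρ} :=
      isClosed_le (continuous_snd.dist continuous_fst) continuous_const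
    exact (measurable_measure_prodMk_left hcl.measurableSet).ennreal_toReal
  rw [irregularSet, ofPred_exists]
  exact MeasurableSet.iUnion fun k => measurableSet_lt measurable_const (hball _)

lemma measureReal_closedBall_le_of_notMem (hs : 0 ≤ s) {C : ℕ} {x : ℝ}
    (hx : x ∉ irregularSet ν s C) {ρ : ℝ} (hρ : 0 < ρ) :
    ν.real (Metric.closedBall x ρ) ≤ (C + 1) * Real.exp s * ρ ^ s := by
  have hes : 1 ≤ Real.exp s := Real.one_le_exp hs
  rcases le_or_gt 1 ρ with h1 | h1
  · have h2 : 1 ≤ ρ ^ s := Real.one_le_rpow h1 hs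
    have h3 : (1 : ℝ) ≤ C + 1 := by linarith [(C.cast_nonneg : (0 : ℝ) ≤ C)]
    exact measureReal_le_one.trans (one_le_mul_of_one_le_of_one_le
      (one_le_mul_of_one_le_of_one_le h3 hes) h2)
  · have hlog : Real.log ρ < 0 := Real.log_neg hρ h1
    have hk1 := Nat.floor_le (show 0 ≤ -Real.log ρ by linarith)
    have hk2 := Nat.lt_floor_add_one (-Real.log ρ)
    set k := ⌊-Real.log ρ⌋₊
    have hxk : ν.real (Metric.closedBall x (Real.exp (-k))) ≤ C * Real.exp (-(k * s)) := by
      by_contra hlt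
      exact hx ⟨k, not_le.1 hlt⟩
    have hρk : ρ ≤ Real.exp (-k) := by
      rw [← Real.log_le_iff_le_exp hρ]
      linarith
    calc ν.real (Metric.closedBall x ρ) ≤ ν.real (Metric.closedBall x (Real.exp (-k))) :=
          measureReal_mono (Metric.closedBall_subset_closedBall hρk)
      _ ≤ C * Real.exp (-(k * s)) := hxk
      _ ≤ (C + 1) * (Real.exp s * ρ ^ s) := by
          have : Real.exp (-(k * s)) ≤ Real.exp s * ρ ^ s := by
            rw [Real.rpow_def_of_pos hρ, ← Real.exp_add, Real.exp_le_exp]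
            nlinarith
          gcongr
          linarith
      _ = _ := by ring

lemma tendsto_measureReal_irregularSet {t : ℝ} (hν : ExactDim1 ν t) (hst : s = 0 ∨ s < t) :
    Tendsto (fun C => ν.real (irregularSet ν s C)) atTop (nhds 0) := by
  have hanti : Antitone (irregularSet ν s) := by
    rintro C D hCD x ⟨k, hk⟩
    refine ⟨k, lt_of_le_of_lt ?_ hk⟩
    gcongr
  have hnull : ν (⋂ C, irregularSet ν s C) = 0 := by
    rw [measure_eq_zero_iff_ae_notMem]
    filter_upwards [hν] with x hx hmem
    rw [mem_iInter] at hmem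
    rcases hst with rfl | hst
    · obtain ⟨k, hk⟩ := hmem 1
      have := measureReal_le_one (μ := ν) (s := Metric.closedBall x (Real.exp (-k)))
      simp at hk
      linarith
    · have hlim : Tendsto (fun k : ℕ => Real.exp (-(k : ℝ))) atTop (nhdsWithin 0 (Ioi 0)) :=
        tendsto_nhdsWithin_iff.2 ⟨Real.tendsto_exp_neg_atTop_nhds_zero.comp
          tendsto_natCast_atTop_atTop, Eventually.of_forall fun k => Real.exp_pos _⟩
      obtain ⟨k₀, hk₀⟩ := eventually_atTop.1
        (((hx.comp hlim).eventually_const_lt hst).and (eventually_gt_atTop 0))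
      have hbig : ∀ k ≥ k₀,
          ν.real (Metric.closedBall x (Real.exp (-k))) ≤ Real.exp (-(k * s)) := by
        intro k hk
        obtain ⟨h1, h2⟩ := hk₀ k hk
        rcases (measureReal_nonneg (μ := ν)
          (s := Metric.closedBall x (Real.exp (-k)))).eq_or_lt with h0 | h0
        · rw [← h0]
          positivity
        · have hk' : -(k : ℝ) < 0 := by simpa using h2
          rw [← Real.log_le_iff_le_exp h0]
          simp only [Function.comp_apply, Real.log_exp] at h1
          rw [lt_div_iff_of_neg hk'] at h1
          change Real.log (ν.real _) < _ at h1
          linarith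
      obtain ⟨k, hk⟩ := hmem (⌈Real.exp (k₀ * |s|)⌉₊ + 1)
      refine absurd hk (not_lt.2 ?_)
      have hce := Nat.le_ceil (Real.exp (k₀ * |s|))
      rcases le_or_gt k₀ k with hkk | hkk
      · refine (hbig k hkk).trans (le_mul_of_one_le_left (Real.exp_pos _).le ?_)
        push_cast
        linarith [(Nat.cast_nonneg ⌈Real.exp (k₀ * |s|)⌉₊ : (0 : ℝ) ≤ _)]
      · calc _ ≤ (1 : ℝ) := measureReal_le_one
          _ ≤ Real.exp (k₀ * |s|) * Real.exp (-(k * s)) := by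
            rw [← Real.exp_add, Real.one_le_exp_iff]
            have : (k : ℝ) ≤ k₀ := by exact_mod_cast hkk.le
            nlinarith [le_abs_self s, abs_nonneg s, (Nat.cast_nonneg k : (0 : ℝ) ≤ k)]
          _ ≤ _ := by
            gcongr
            push_cast
            linarith
  have := tendsto_measure_iInter_atTop (μ := ν)
    (fun C => (measurableSet_irregularSet (ν := ν) (s := s) C).nullMeasurableSet) hanti
    ⟨0, measure_ne_top ν _⟩
  rw [hnull] at this
  exact (ENNReal.tendsto_toReal ENNReal.zero_ne_top).comp this

end Irregular

section LocalDimension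

variable {I : Type} [Fintype I] [MeasurableSpace I] {T : System I} {Pi : (ℕ → I) → ℝ × ℝ}
  {F : Set (ℝ × ℝ)} {m : Measure (ℕ → I)} [IsProbabilityMeasure m]

lemma IsCoding.measurableEmbedding (hPi : IsCoding T Pi) (hPim : Measurable Pi)
    (hF : IsAttractor T F) (hSSC : SSC T F) (hs : Measurable (shift : (ℕ → I) → ℕ → I)) :
    MeasurableEmbedding Pi := by
  have : MeasurableSingletonClass I := by
    refine ⟨fun i => ?_⟩
    have hconst : Measurable fun (j : I) (_ : ℕ) => j :=
      measurable_pi_lambda _ fun _ => measurable_id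
    have hi := hconst (hPi.measurableSet_cyl hPim hF hSSC hs [i])
    convert hi
    ext j
    simp [cyl]
  obtain ⟨κ, hκ, hsep⟩ := hPi.exists_word_eq hF hSSC
  refine hPim.measurableEmbedding fun ii jj hij => ?_
  funext k
  have h := hsep ii jj (k + 1) 0 zero_mem_sq (by
    rw [← hij]
    simpa [dE, hκ] using abs_pos.1 (gyw_bounds T (word ii (k + 1)) zero_mem_sq).1)
  exact (word_eq_word_iff.1 h k (Nat.lt_succ_self k)).symm

/-- Balls around `Π(i)` of radius at least the diameter of `S_{i|n}` contain the cylinder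
`[i|n]`. -/
lemma IsCoding.measureReal_cyl_le (hPi : IsCoding T Pi) (hPim : Measurable Pi) :
    ∃ c : ℝ, 0 < c ∧ c < 1 ∧ ∀ (ii : ℕ → I) (n : ℕ) (r : ℝ), c ^ n * 2 ≤ r →
      m.real (cyl (word ii n)) ≤ (m.map Pi).real (ballE (Pi ii) r) := by
  obtain ⟨c, hc0, hc1, hc⟩ := exists_dE_Sw_le T
  refine ⟨c, hc0, hc1, fun ii n r hr => ?_⟩
  rw [map_measureReal_apply hPim (measurableSet_ballE _ _)]
  refine measureReal_mono fun jj hjj => ?_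
  have hw := mem_cyl_word_iff.1 hjj
  change dE (Pi ii) (Pi jj) ≤ r
  rw [hPi.eq_Sw ii n, hPi.eq_Sw jj n, hw]
  refine (hc _ _ (hPi.mem_sq _) _ (hPi.mem_sq _)).trans (le_trans ?_ hr)
  rw [length_word]
  gcongr
  exact dE_le_two (hPi.mem_sq _) (hPi.mem_sq _)

end LocalDimension

section LowerBound

variable {I : Type} [Fintype I] [MeasurableSpace I] {T : System I} {Pi : (ℕ → I) → ℝ × ℝ}
  {F : Set (ℝ × ℝ)} {m : Measure (ℕ → I)} [IsProbabilityMeasure m] {L : ℝ}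

lemma IsCoding.eventually_measureReal_ballE_le (hPi : IsCoding T Pi) (hPim : Measurable Pi)
    (hF : IsAttractor T F) (hSSC : SSC T F) (hs : Measurable (shift : (ℕ → I) → ℕ → I))
    (hQB : QuasiBernoulli m L) {ii : ℕ → I} {h χ₁ χ₂ ε s : ℝ} {C : ℕ} (hε : 0 < ε) (hs0 : 0 ≤ s)
    (hpos : ∀ n, 0 < m.real (cyl (word ii n)))
    (hent : Tendsto (fun n : ℕ => Real.log (m.real (cyl (word ii n))) / n) atTop (nhds h))
    (hly1 : Tendsto
      (fun n : ℕ => Real.log (alpha1 T (word ii n) (Pi (shiftn ii n))) / n) atTop (nhds χ₁))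
    (hly2 : Tendsto
      (fun n : ℕ => Real.log (alpha2 T (word ii n) (Pi (shiftn ii n))) / n) atTop (nhds χ₂)) :
    ∃ D : ℝ, 0 < D ∧ ∀ᶠ n : ℕ in atTop,
      (Pi (shiftn ii n)).1 ∉ irregularSet ((m.map Pi).map Prod.fst) s C →
      ∀ r, 0 < r → r ≤ Real.exp (n * (χ₂ - ε)) →
        (m.map Pi).real (ballE (Pi ii) r) ≤
          D * Real.exp (n * (h + ε - s * (χ₁ - ε))) * r ^ s := by
  have := Measure.isProbabilityMeasure_map (μ := m) hPim.aemeasurable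
  have := Measure.isProbabilityMeasure_map (μ := m.map Pi) measurable_fst.aemeasurable
  have hL := hQB.1
  obtain ⟨κ, hκ, K, hK, hball⟩ := hPi.exists_measureReal_ballE_le hPim hF hSSC hs hQB
  obtain ⟨C', hC', hα⟩ := exists_alpha_le T
  have hα := fun n => hα (word ii n) _ (hPi.mem_sq (shiftn ii n))
  refine ⟨L * ((C + 1) * Real.exp s * K ^ s), by positivity, ?_⟩
  filter_upwards [eventually_le_exp hpos hent (lt_add_of_pos_right h hε),
    eventually_exp_le (fun n => mul_pos (inv_pos.2 hC') (hα n).1)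
      (tendsto_log_const_mul_div (inv_pos.2 hC') (fun n => (hα n).1) hly1) (sub_lt_self χ₁ hε),
    eventually_exp_le (fun n => mul_pos (show 0 < κ / 2 * C'⁻¹ by positivity) (hα n).2.1)
      (tendsto_log_const_mul_div (by positivity) (fun n => (hα n).2.1) hly2)
      (sub_lt_self χ₂ hε)] with n hn1 hn2 hn3 hreg r hr hrb
  obtain ⟨-, -, h1, h2⟩ := hα n
  have hg := (gyw_bounds T (word ii n) (hPi.mem_sq (shiftn ii n))).1
  set p := Pi (shiftn ii n)
  have hf : Real.exp (n * (χ₁ - ε)) ≤ |fxw T (word ii n) p| :=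
    hn2.trans ((inv_mul_le_iff₀ hC').2 h1)
  have hrlt : r < κ * |gyw T (word ii n) p| := by
    have h3 : C'⁻¹ * alpha2 T (word ii n) p ≤ |gyw T (word ii n) p| := (inv_mul_le_iff₀ hC').2 h2
    calc r ≤ κ / 2 * C'⁻¹ * alpha2 T (word ii n) p := hrb.trans hn3
      _ ≤ κ / 2 * |gyw T (word ii n) p| := by rw [mul_assoc]; gcongr
      _ < κ * |gyw T (word ii n) p| := by gcongr; linarith
  have hfpos : 0 < |fxw T (word ii n) p| := (Real.exp_pos _).trans_le hf
  have hpow : (K * r / |fxw T (word ii n) p|) ^ s ≤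
      K ^ s * r ^ s * Real.exp (-(n * (s * (χ₁ - ε)))) := by
    calc _ ≤ (K * r / Real.exp (n * (χ₁ - ε))) ^ s := by gcongr
      _ = _ := by
        rw [div_eq_mul_inv, ← Real.exp_neg, Real.mul_rpow (by positivity) (Real.exp_pos _).le,
          Real.mul_rpow hK.le hr.le, ← Real.exp_mul]
        ring_nf
  calc _ ≤ L * m.real (cyl (word ii n)) * ((m.map Pi).map Prod.fst).real
        (Metric.closedBall p.1 (K * r / |fxw T (word ii n) p|)) := hball ii n r hr hrlt
    _ ≤ L * Real.exp (n * (h + ε)) * ((C + 1) * Real.exp s *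
        (K ^ s * r ^ s * Real.exp (-(n * (s * (χ₁ - ε)))))) := by
      gcongr
      exact (measureReal_closedBall_le_of_notMem hs0 hreg (by positivity)).trans (by gcongr)
    _ = _ := by
      rw [show n * (h + ε - s * (χ₁ - ε)) = n * (h + ε) + -(n * (s * (χ₁ - ε))) by ring,
        Real.exp_add]
      ring

lemma ae_exists_forall_exists_notMem_irregularSet
    (hPim : Measurable Pi) (hshift : MeasurePreserving (shift : (ℕ → I) → ℕ → I) m m)
    {t s ε : ℝ} (hproj : ExactDim1 ((m.map Pi).map Prod.fst) t) (hst : s = 0 ∨ s < t)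
    (hε : 0 < ε) (hε1 : ε ≤ 1) :
    ∀ᵐ ii ∂m, ∃ C : ℕ, ∀ n : ℕ, 1 ≤ n → ∃ k : ℕ, (1 - ε) * n ≤ k ∧ k ≤ n ∧
      (Pi (shiftn ii k)).1 ∉ irregularSet ((m.map Pi).map Prod.fst) s C := by
  have := Measure.isProbabilityMeasure_map (μ := m) hPim.aemeasurable
  have := Measure.isProbabilityMeasure_map (μ := m.map Pi) measurable_fst.aemeasurable
  have hlim := tendsto_measureReal_irregularSet hproj hst
  set ν := (m.map Pi).map Prod.fst
  have hA : ∀ C, m.real (Pi ⁻¹' (Prod.fst ⁻¹' irregularSet ν s C)) =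
      ν.real (irregularSet ν s C) := by
    intro C
    have hC : MeasurableSet (irregularSet ν s C) := measurableSet_irregularSet C
    rw [map_measureReal_apply measurable_fst hC, map_measureReal_apply hPim (measurable_fst hC)]
  have := ae_exists_forall_exists_iterate_notMem
    (A := fun C => Pi ⁻¹' (Prod.fst ⁻¹' irregularSet ν s C)) hshift
    (fun C => hPim (measurable_fst (measurableSet_irregularSet C))) (by simpa only [hA]) hε hε1
  filter_upwards [this] with ii hii
  simpa only [iterate_shift, mem_preimage] using hii

/-- The exponent bound obtained from an error tolerance `ε`, before letting `ε → 0`. -/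
lemma IsCoding.ae_le_liminf (hPi : IsCoding T Pi) (hPim : Measurable Pi)
    (hF : IsAttractor T F) (hSSC : SSC T F)
    (hshift : MeasurePreserving (shift : (ℕ → I) → ℕ → I) m m) (hQB : QuasiBernoulli m L)
    {h χ₁ χ₂ t s ε : ℝ} (hh : h ≤ 0) (hχ2 : χ₂ < 0)
    (hent : ∀ᵐ ii ∂m, Tendsto
      (fun n : ℕ => Real.log (m.real (cyl (word ii n))) / n) atTop (nhds h))
    (hly1 : ∀ᵐ ii ∂m, Tendsto
      (fun n : ℕ => Real.log (alpha1 T (word ii n) (Pi (shiftn ii n))) / n) atTop (nhds χ₁))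
    (hly2 : ∀ᵐ ii ∂m, Tendsto
      (fun n : ℕ => Real.log (alpha2 T (word ii n) (Pi (shiftn ii n))) / n) atTop (nhds χ₂))
    (hproj : ExactDim1 ((m.map Pi).map Prod.fst) t) (hs0 : 0 ≤ s) (hst : s = 0 ∨ s < t)
    (hε : 0 < ε) (hε1 : ε < 1) :
    ∀ᵐ ii ∂m, (h + ε - s * (χ₁ - ε) + ε * |h + ε - s * (χ₁ - ε)|) / (χ₂ - ε) + s - ε ≤
      liminf (fun r => Real.log ((m.map Pi).real (ballE (Pi ii) r)) / Real.log r)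
        (nhdsWithin 0 (Ioi 0)) := by
  have := Measure.isProbabilityMeasure_map (μ := m) hPim.aemeasurable
  obtain ⟨c, hc0, hc1, hc⟩ := hPi.measureReal_cyl_le hPim (m := m)
  filter_upwards [hent, hly1, hly2, ae_forall_measureReal_cyl_pos (m := m),
    ae_exists_forall_exists_notMem_irregularSet hPim hshift hproj hst hε hε1.le]
    with ii h1 h2 h3 hpos hreg
  obtain ⟨C, hC⟩ := hreg
  obtain ⟨D, hD, H⟩ := hPi.eventually_measureReal_ballE_le hPim hF hSSC hshift.measurable hQB
    (C := C) hε hs0 hpos h1 h2 h3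
  have hM : ∀ r > 0, 0 < (m.map Pi).real (ballE (Pi ii) r) := by
    intro r hr
    obtain ⟨n, hn⟩ := exists_pow_lt_of_lt_one (half_pos hr) hc1
    exact (hpos n).trans_le (hc ii n r (by linarith))
  refine le_liminf_of_le ?_
    (eventually_le_log_div_log hM hε hε1 (by linarith) hD hC H)
  refine isCoboundedUnder_log_div_log hc0 hc1 (show h - 1 < 0 by linarith) ?_
  filter_upwards [eventually_exp_le hpos h1 (sub_one_lt h)] with n hn r hr
  exact hn.trans (hc ii n r hr)

end LowerBound

end FFL

open FFL

/-- lower bound for the lower local dimension of `μ`. -/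
theorem stmt18 {I : Type} [Fintype I] [MeasurableSpace I] (T : System I)
    (F : Set (ℝ × ℝ)) (hF : IsAttractor T F) (hSSC : SSC T F)
    (Pi : (ℕ → I) → ℝ × ℝ) (hPi : IsCoding T Pi) (hPim : Measurable Pi)
    (m : Measure (ℕ → I)) [IsProbabilityMeasure m]
    (hshift : MeasurePreserving (shift : (ℕ → I) → ℕ → I) m m)
    (L : ℝ) (hQB : QuasiBernoulli m L)
    (herg : Ergodic (shift : (ℕ → I) → ℕ → I) m)
    (h χ₁ χ₂ t : ℝ) (hh : h ≤ 0) (hχ21 : χ₂ ≤ χ₁) (hχ1 : χ₁ < 0)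
    (hent : ∀ᵐ ii ∂m, Tendsto
      (fun n : ℕ => Real.log (m (cyl (word ii n))).toReal / n) atTop (nhds h))
    (hly1 : ∀ᵐ ii ∂m, Tendsto
      (fun n : ℕ => Real.log (alpha1 T (word ii n) (Pi (shiftn ii n))) / n) atTop (nhds χ₁))
    (hly2 : ∀ᵐ ii ∂m, Tendsto
      (fun n : ℕ => Real.log (alpha2 T (word ii n) (Pi (shiftn ii n))) / n) atTop (nhds χ₂))
    (hproj : ExactDim1 ((m.map Pi).map Prod.fst) t) :
    ∀ᵐ x ∂(m.map Pi),
      h / χ₂ + (χ₂ - χ₁) / χ₂ * t ≤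
        Filter.liminf (fun r => Real.log ((m.map Pi) (ballE x r)).toReal / Real.log r)
          (nhdsWithin 0 (Set.Ioi 0)) := by
  have hχ2 : χ₂ < 0 := hχ21.trans_lt hχ1
  rw [(hPi.measurableEmbedding hPim hF hSSC hshift.measurable).ae_map_iff]
  have hε : ∀ j : ℕ, (0 : ℝ) < 1 / (j + 2) ∧ (1 : ℝ) / (j + 2) < 1 := fun j => by
    have : (0 : ℝ) ≤ j := j.cast_nonneg
    exact ⟨by positivity, by rw [div_lt_one (by positivity)]; linarith⟩
  have hbound := fun j : ℕ => hPi.ae_le_liminf hPim hF hSSC hshift hQB hh hχ2 hent hly1 hly2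
    hproj (le_max_left 0 (t - 1 / (j + 2)))
    ((max_choice 0 (t - 1 / ((j : ℝ) + 2))).imp id fun h0 => by rw [h0]; linarith [(hε j).1])
    (hε j).1 (hε j).2
  filter_upwards [ae_all_iff.2 hbound] with ii hii
  have hlim : Tendsto (fun j : ℕ => (1 : ℝ) / (j + 2)) atTop (nhds 0) :=
    tendsto_const_nhds.div_atTop
      (tendsto_atTop_add_const_right _ _ tendsto_natCast_atTop_atTop)
  have hcont : ContinuousAt (fun ε : ℝ => (h + ε - max 0 (t - ε) * (χ₁ - ε) +
      ε * |h + ε - max 0 (t - ε) * (χ₁ - ε)|) / (χ₂ - ε) + max 0 (t - ε) - ε) 0 := by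
    have : χ₂ - 0 ≠ 0 := by simpa using hχ2.ne
    fun_prop (disch := assumption)
  refine le_trans ?_ (le_of_tendsto' (hcont.tendsto.comp hlim) hii)
  have hcoef : 0 ≤ (χ₂ - χ₁) / χ₂ := div_nonneg_of_nonpos (by linarith) hχ2.le
  calc h / χ₂ + (χ₂ - χ₁) / χ₂ * t ≤ h / χ₂ + (χ₂ - χ₁) / χ₂ * max 0 t := by
        gcongr
        exact le_max_right _ _
    _ = _ := by
      have hne := hχ2.ne
      simp only [sub_zero, add_zero, zero_mul]
      field_simp
      ring
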